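/- arXiv:0906.5345 — 2 statements merged into one kernel-verified Lean document; each statement's English description precedes it below -/
import Mathlib

section
/- Orbit equivalence is preserved by the construction Γ₀ ↦ (Γ₀ × F₂) ∗ ℤ: if Γ₀ and Λ₀ are countable groups admitting free, ergodic, probability-measure-preserving actions on a common standard Borel probability space (X, μ) whose orbits agree μ-almost everywhere, then the groups (Γ₀ × F₂) ∗ ℤ and (Λ₀ × F₂) ∗ ℤ also admit free, ergodic, probability-measure-preserving actions on a common standard Borel probability space whose orbits agree almost everywhere. -/
open MeasureTheory

/-- A p.m.p. action: every group element acts as a measure-preserving (measurable) map. -/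
def IsPMPAction {G X : Type*} [Group G] [MeasurableSpace X]
    (μ : Measure X) (a : G →* Equiv.Perm X) : Prop :=
  ∀ g : G, MeasurePreserving (a g) μ μ

/-- Essential freeness of an action. -/
def IsFreeAction {G X : Type*} [Group G] [MeasurableSpace X]
    (μ : Measure X) (a : G →* Equiv.Perm X) : Prop :=
  ∀ g : G, g ≠ 1 → μ {x | a g x = x} = 0

/-- Ergodicity of an action. -/
def IsErgodicAction {G X : Type*} [Group G] [MeasurableSpace X]
    (μ : Measure X) (a : G →* Equiv.Perm X) : Prop :=
  ∀ A : Set X, MeasurableSet A → (∀ g : G, a g ⁻¹' A = A) → μ A = 0 ∨ μ A = 1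

/-- The orbit of a point under an action. -/
def orbitOf {G X : Type*} [Group G] (a : G →* Equiv.Perm X) (x : X) : Set X :=
  Set.range fun g => a g x

/-- Two groups are orbit equivalent if they admit free, ergodic, p.m.p. actions on a
common standard Borel probability space whose orbits agree almost everywhere. -/
def AreOrbitEquivalent (G H : Type*) [Group G] [Group H] : Prop :=
  ∃ (X : Type) (mX : MeasurableSpace X) (μ : @Measure X mX),
    @StandardBorelSpace X mX ∧ @IsProbabilityMeasure X mX μ ∧
    ∃ (a : G →* Equiv.Perm X) (b : H →* Equiv.Perm X),
      IsPMPAction μ a ∧ IsFreeAction μ a ∧ IsErgodicAction μ a ∧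
      IsPMPAction μ b ∧ IsFreeAction μ b ∧ IsErgodicAction μ b ∧
      ∀ᵐ x ∂μ, orbitOf a x = orbitOf b x


namespace OEProof
set_option linter.unusedSectionVars false
open Measure ProbabilityTheory
open scoped symmDiff

/-- The Bernoulli measure on `G → ℝ`. -/
noncomputable def bern (G : Type) : Measure (G → ℝ) :=
  Measure.infinitePi fun _ : G => gaussianReal 0 1

instance (G : Type) : IsProbabilityMeasure (bern G) := by
  unfold bern; infer_instance

/-- The shift action. -/
def sh (G : Type) [Group G] : G →* Equiv.Perm (G → ℝ) where
  toFun g :=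
    { toFun := fun w k => w (g⁻¹ * k)
      invFun := fun w k => w (g * k)
      left_inv := fun w => by funext k; simp
      right_inv := fun w => by funext k; simp }
  map_one' := by ext w k; simp
  map_mul' g h := by ext w k; simp [mul_assoc]

@[simp] lemma sh_apply {G : Type} [Group G] (g : G) (w : G → ℝ) (k : G) :
    sh G g w k = w (g⁻¹ * k) := rfl

lemma sh_mp {G : Type} [Group G] (g : G) : MeasurePreserving (sh G g) (bern G) (bern G) := by
  refine ⟨measurable_pi_lambda _ fun k => measurable_pi_apply _, ?_⟩
  have := Measure.map_infinitePi_infinitePi_of_inj (P := fun _ : G => gaussianReal 0 1)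
    (mul_right_injective g⁻¹)
  exact this

lemma sh_free {G : Type} [Group G] (g : G) (hg : g ≠ 1) : bern G {w | sh G g w = w} = 0 := by
  have h1 : (g⁻¹ : G) ≠ 1 := by simpa using hg
  have key := Measure.infinitePi_map_eval_prod (P := fun _ : G => gaussianReal 0 1) h1
  have hd : MeasurableSet {p : ℝ × ℝ | p.1 = p.2} := measurableSet_eq_fun measurable_fst measurable_snd
  have h0 : ((gaussianReal 0 1).prod (gaussianReal 0 1)) {p : ℝ × ℝ | p.1 = p.2} = 0 := by
    rw [Measure.measure_prod_null hd]
    refine Filter.Eventually.of_forall fun x => ?_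
    have : (Prod.mk x ⁻¹' {p : ℝ × ℝ | p.1 = p.2}) = {x} := by ext y; simp [eq_comm]
    show gaussianReal 0 1 _ = 0
    rw [this]
    have := nullSingletonClass_gaussianReal (μ := 0) (v := 1) one_ne_zero
    simp
  rw [← key, Measure.map_apply (by fun_prop) hd] at h0
  refine measure_mono_null ?_ h0
  intro w hw
  have := congrFun hw 1
  simpa using this

lemma sh_indep {G : Type} [Group G] (g : G) (S : Finset G) (U : Set (S → ℝ)) (hU : MeasurableSet U)
    (hS : ∀ k ∈ S, g⁻¹ * k ∉ S) :
    (bern G).real (cylinder S U ∩ sh G g ⁻¹' cylinder S U)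
      = (bern G).real (cylinder S U) * (bern G).real (cylinder S U) := by
  classical
  let T : Finset G := S.image (fun k => g⁻¹ * k)
  have hST : Disjoint S T := by
    rw [Finset.disjoint_left]
    intro x hx hxT
    obtain ⟨k, hk, rfl⟩ := Finset.mem_image.1 hxT
    exact hS k hk hx
  have hi : iIndepFun (fun (i : G) (w : G → ℝ) => w i) (bern G) :=
    iIndepFun_infinitePi (P := fun _ : G => gaussianReal 0 1) (X := fun _ w => w) (by fun_prop)
  have h2 := hi.indepFun_finset S T hST (by fun_prop)
  let φ : (T → ℝ) → (S → ℝ) := fun v k =>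
    v ⟨g⁻¹ * k, Finset.mem_image.2 ⟨k, k.2, rfl⟩⟩
  have hφ : Measurable φ := by fun_prop
  have h3 := h2.comp measurable_id hφ
  have h4 := h3.measure_inter_preimage_eq_mul U U hU hU
  have h5 : bern G (sh G g ⁻¹' cylinder S U) = bern G (cylinder S U) :=
    (sh_mp g).measure_preimage hU.cylinder.nullMeasurableSet
  have h6 : bern G (cylinder S U ∩ sh G g ⁻¹' cylinder S U)
      = bern G (cylinder S U) * bern G (sh G g ⁻¹' cylinder S U) := h4
  simp [Measure.real, h6, h5]

lemma sh_ergodic {G : Type} [Group G] (t : G) (ht : ∀ n : ℕ, n ≠ 0 → t ^ n ≠ 1)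
    (A : Set (G → ℝ)) (hA : MeasurableSet A) (hinv : sh G t ⁻¹' A = A) :
    bern G A = 0 ∨ bern G A = 1 := by
  classical
  have hpow : ∀ n : ℕ, sh G (t ^ n) ⁻¹' A = A := by
    intro n
    induction n with
    | zero => simp
    | succ n ih =>
      rw [pow_succ, map_mul, Equiv.Perm.coe_mul, Set.preimage_comp, ih, hinv]
  have hinj : Function.Injective (fun n : ℕ => t ^ n) := by
    rw [injective_pow_iff_not_isOfFinOrder, isOfFinOrder_iff_pow_eq_one]
    rintro ⟨n, hn, h⟩
    exact ht n hn.ne' h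
  have main : ∀ ε : ℝ, 0 < ε →
      |(bern G).real A - (bern G).real A * (bern G).real A| ≤ 4 * ε := by
    intro ε hε
    obtain ⟨C, hC, hCA⟩ := exists_measure_symmDiff_lt_of_generateFrom_isSetRing
      (μ := bern G) (C := measurableCylinders fun _ : G => ℝ) isSetRing_measurableCylinders
      ⟨{Set.univ}, by simp, by
        simpa using (isSetAlgebra_measurableCylinders (α := fun _ : G => ℝ)).univ_mem, by simp⟩
      generateFrom_measurableCylinders.symm hA (ε := ENNReal.ofReal ε) (by simpa using hε)
    obtain ⟨S, U, hU, rfl⟩ := (mem_measurableCylinders _).1 hC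
    obtain ⟨n, hn⟩ : ∃ n : ℕ, t ^ n ∉ ((S ×ˢ S).image fun p => p.1 * p.2⁻¹ : Finset G) := by
      by_contra! h
      exact Set.infinite_of_injective_forall_mem hinj h (Finset.finite_toSet _)
    set g := t ^ n with hg
    have hind := sh_indep g S U hU (by
      intro k hk hk'
      apply hn
      refine Finset.mem_image.2 ⟨(k, g⁻¹ * k), by simp [hk, hk'], by simp⟩)
    set C : Set (G → ℝ) := cylinder S U with hCdef
    have hCm : MeasurableSet C := hU.cylinder
    have hgm : Measurable (sh G g) := (sh_mp g).measurable
    have e1 : (bern G).real (C ∆ A) ≤ ε := by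
      rw [Measure.real]
      exact ENNReal.toReal_le_of_le_ofReal hε.le hCA.le
    have e2 : (bern G).real (sh G g ⁻¹' (C ∆ A)) ≤ ε := by
      rw [Measure.real, (sh_mp g).measure_preimage (hCm.symmDiff hA).nullMeasurableSet]
      exact e1
    have e3 : (bern G).real ((C ∩ sh G g ⁻¹' C) ∆ A) ≤ 2 * ε := by
      calc _ ≤ (bern G).real (C ∆ A ∪ sh G g ⁻¹' (C ∆ A)) := by
            apply measureReal_mono
            · rw [Set.preimage_symmDiff, hpow n]
              intro w
              simp only [Set.mem_symmDiff, Set.mem_union, Set.mem_inter_iff]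
              tauto
            · finiteness
        _ ≤ _ := measureReal_union_le _ _
        _ ≤ _ := by linarith
    have e4 := abs_measureReal_sub_le_measureReal_symmDiff (μ := bern G)
      (hCm.inter (hgm hCm)).nullMeasurableSet hA.nullMeasurableSet
    have e5 := abs_measureReal_sub_le_measureReal_symmDiff (μ := bern G)
      hCm.nullMeasurableSet hA.nullMeasurableSet
    rw [hind] at e4
    have c0 : 0 ≤ (bern G).real C := measureReal_nonneg
    have c1 : (bern G).real C ≤ 1 := measureReal_le_one
    have a0 : 0 ≤ (bern G).real A := measureReal_nonneg
    have a1 : (bern G).real A ≤ 1 := measureReal_le_one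
    generalize (bern G).real C = c at *
    generalize (bern G).real A = a at *
    have e4' := abs_le.1 (e4.trans e3)
    have e5' := abs_le.1 (e5.trans e1)
    rw [abs_le]
    constructor <;> nlinarith
  have h0 : (bern G).real A - (bern G).real A * (bern G).real A = 0 := by
    by_contra hne
    have hp := abs_pos.2 hne
    have := main (|(bern G).real A - (bern G).real A * (bern G).real A| / 8) (by positivity)
    linarith
  have h1 : (bern G).real A * (1 - (bern G).real A) = 0 := by linarith
  rcases mul_eq_zero.1 h1 with h | h
  · left
    simpa [Measure.real, ENNReal.toReal_eq_zero_iff] using h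
  · right
    have : (bern G A).toReal = 1 := by simp only [Measure.real] at h; linarith
    simpa [ENNReal.toReal_eq_one_iff] using this

/-- Permutations of `X` together with a `G`-valued cocycle. -/
structure Skew (X G : Type) where
  base : Equiv.Perm X
  coc : X → G

namespace Skew
variable {X G : Type} [Group G]

lemma ext' {s t : Skew X G} (h1 : s.base = t.base) (h2 : ∀ x, s.coc x = t.coc x) : s = t := by
  cases s; cases t
  simp only [Skew.mk.injEq]
  exact ⟨h1, funext h2⟩

instance : One (Skew X G) := ⟨⟨1, fun _ => 1⟩⟩
instance : Mul (Skew X G) := ⟨fun s t => ⟨s.base * t.base, fun x => s.coc (t.base x) * t.coc x⟩⟩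
instance : Inv (Skew X G) := ⟨fun s => ⟨s.base⁻¹, fun x => (s.coc (s.base⁻¹ x))⁻¹⟩⟩

@[simp] lemma one_base : (1 : Skew X G).base = 1 := rfl
@[simp] lemma one_coc (x : X) : (1 : Skew X G).coc x = 1 := rfl
@[simp] lemma mul_base (s t : Skew X G) : (s * t).base = s.base * t.base := rfl
@[simp] lemma mul_coc (s t : Skew X G) (x : X) :
    (s * t).coc x = s.coc (t.base x) * t.coc x := rfl
@[simp] lemma inv_base (s : Skew X G) : (s⁻¹).base = s.base⁻¹ := rfl
@[simp] lemma inv_coc (s : Skew X G) (x : X) : (s⁻¹).coc x = (s.coc (s.base⁻¹ x))⁻¹ := rfl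

instance : Group (Skew X G) where
  mul_assoc s t u := ext' (by simp [mul_assoc]) (fun x => by simp [mul_assoc])
  one_mul s := ext' (by simp) (fun x => by simp)
  mul_one s := ext' (by simp) (fun x => by simp)
  inv_mul_cancel s := ext' (by simp) (fun x => by simp)

/-- The action of the skew group on `X × (G → ℝ)`. -/
def act : Skew X G →* Equiv.Perm (X × (G → ℝ)) :=
  MonoidHom.toHomPerm
    { toFun := fun s p => (s.base p.1, sh G (s.coc p.1) p.2)
      map_one' := by funext p; simp; rfl
      map_mul' := fun s t => by
        funext p
        simp only [mul_base, mul_coc, map_mul, Equiv.Perm.coe_mul, Function.comp_apply]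
        rfl }

lemma act_apply (s : Skew X G) (p : X × (G → ℝ)) :
    act s p = (s.base p.1, sh G (s.coc p.1) p.2) := rfl

end Skew

section general

variable {X G H : Type} [Group G] [Group H] [Countable G] [Countable H] [MeasurableSpace X]
  [StandardBorelSpace X] (μ : Measure X) [IsProbabilityMeasure μ] (Φ : H →* Skew X G)

/-- the action of `H` -/
def skAct : H →* Equiv.Perm (X × (G → ℝ)) := Skew.act.comp Φ

lemma skAct_apply (h : H) (p : X × (G → ℝ)) :
    skAct Φ h p = ((Φ h).base p.1, sh G ((Φ h).coc p.1) p.2) := rfl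

lemma measurable_skAct (hb : ∀ h, Measurable (Φ h).base)
    (hc : ∀ h g, MeasurableSet {x | (Φ h).coc x = g}) (h : H) : Measurable (skAct Φ h) := by
  refine Measurable.prodMk ((hb h).comp measurable_fst) ?_
  refine measurable_pi_lambda _ fun k => ?_
  show Measurable fun p : X × (G → ℝ) => p.2 (((Φ h).coc p.1)⁻¹ * k)
  let _ : MeasurableSpace G := ⊤
  have hm : Measurable (Φ h).coc := measurable_to_countable' (fun g => hc h g)
  have h2 : Measurable fun q : G × (G → ℝ) => q.2 (q.1⁻¹ * k) :=
    measurable_from_prod_countable_right fun g => measurable_pi_apply (g⁻¹ * k)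
  exact h2.comp ((hm.comp measurable_fst).prodMk measurable_snd)

lemma skAct_pmp (hb : ∀ h, MeasurePreserving (Φ h).base μ μ)
    (hc : ∀ h g, MeasurableSet {x | (Φ h).coc x = g}) :
    IsPMPAction (μ.prod (bern G)) (skAct Φ) := by
  intro h
  have hm := measurable_skAct Φ (fun h => (hb h).measurable) hc h
  exact (hb h).skew_product (g := fun x w => sh G ((Φ h).coc x) w) (μc := bern G) (μd := bern G)
    (hm.snd) (Filter.Eventually.of_forall fun x => (sh_mp _).map_eq)

lemma skAct_free (hb : ∀ h, Measurable (Φ h).base)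
    (hc : ∀ h g, MeasurableSet {x | (Φ h).coc x = g})
    (hne : ∀ᵐ x ∂μ, ∀ h, h ≠ 1 → (Φ h).coc x ≠ 1) :
    IsFreeAction (μ.prod (bern G)) (skAct Φ) := by
  intro h hh
  have hm := measurable_skAct Φ hb hc h
  have hms : MeasurableSet {p | skAct Φ h p = p} := measurableSet_eq_fun hm measurable_id
  rw [Measure.measure_prod_null hms]
  filter_upwards [hne] with x hx
  refine measure_mono_null ?_ (sh_free _ (hx h hh))
  intro w hw
  exact congrArg Prod.snd hw

lemma skAct_ergodic
    (herg : ∀ A : Set X, MeasurableSet A → (∀ h, (Φ h).base ⁻¹' A = A) → μ A = 0 ∨ μ A = 1)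
    (t : H) (g₀ : G) (hg : ∀ n : ℕ, n ≠ 0 → g₀ ^ n ≠ 1)
    (ht1 : (Φ t).base = 1) (ht2 : ∀ x, (Φ t).coc x = g₀) :
    IsErgodicAction (μ.prod (bern G)) (skAct Φ) := by
  intro A hA hinv
  have hsec : ∀ h x, sh G ((Φ h).coc x) ⁻¹' (Prod.mk ((Φ h).base x) ⁻¹' A) = Prod.mk x ⁻¹' A := by
    intro h x
    ext w
    have : (x, w) ∈ skAct Φ h ⁻¹' A ↔ (x, w) ∈ A := by rw [hinv h]
    exact this
  have h01 : ∀ x, bern G (Prod.mk x ⁻¹' A) = 0 ∨ bern G (Prod.mk x ⁻¹' A) = 1 := by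
    intro x
    refine sh_ergodic g₀ hg _ (measurable_prodMk_left hA) ?_
    have := hsec t x
    rwa [ht1, ht2] at this
  have hmeas : Measurable fun x => bern G (Prod.mk x ⁻¹' A) := measurable_measure_prodMk_left hA
  have hinv' : ∀ h x, bern G (Prod.mk ((Φ h).base x) ⁻¹' A) = bern G (Prod.mk x ⁻¹' A) := by
    intro h x
    rw [← hsec h x, (sh_mp _).measure_preimage (measurable_prodMk_left hA).nullMeasurableSet]
  have hE := herg {x | bern G (Prod.mk x ⁻¹' A) = 1} (hmeas (measurableSet_singleton 1)) (by
    intro h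
    ext x
    simp [hinv'])
  rw [Measure.prod_apply hA]
  rcases hE with h | h
  · left
    rw [lintegral_eq_zero_iff hmeas]
    have : ∀ᵐ x ∂μ, ¬ bern G (Prod.mk x ⁻¹' A) = 1 := by
      rw [ae_iff]; simpa using h
    filter_upwards [this] with x hx
    exact (h01 x).resolve_right hx
  · right
    have : ∀ᵐ x ∂μ, bern G (Prod.mk x ⁻¹' A) = 1 :=
      (prob_compl_eq_zero_iff (hmeas (measurableSet_singleton 1))).2 h
    rw [lintegral_congr_ae this]
    simp

end general


/-- The group `(Γ₀ × F₂) ∗ ℤ`. -/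
abbrev Big (Γ₀ : Type) [Group Γ₀] : Type :=
  Monoid.Coprod (Γ₀ × FreeGroup (Fin 2)) (Multiplicative ℤ)

instance countable_big (Γ₀ : Type) [Group Γ₀] [Countable Γ₀] : Countable (Big Γ₀) := by
  have h1 : Countable (FreeGroup (Fin 2)) :=
    Function.Surjective.countable (f := FreeGroup.mk) Quot.mk_surjective
  have h2 : Countable (FreeMonoid ((Γ₀ × FreeGroup (Fin 2)) ⊕ Multiplicative ℤ)) :=
    inferInstanceAs (Countable (List ((Γ₀ × FreeGroup (Fin 2)) ⊕ Multiplicative ℤ)))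
  exact Function.Surjective.countable (Monoid.Coprod.mk_surjective)

section ext
variable {X Γ₀ Λ₀ : Type} [Group Γ₀] [Group Λ₀]

/-- The retraction to the first factor. -/
def proj (Γ₀ : Type) [Group Γ₀] : Big Γ₀ →* Γ₀ := (MonoidHom.fst _ _).comp Monoid.Coprod.fst

@[simp] lemma proj_inl (p : Γ₀ × FreeGroup (Fin 2)) : proj Γ₀ (Monoid.Coprod.inl p) = p.1 := rfl
@[simp] lemma proj_inr (n : Multiplicative ℤ) : proj Γ₀ (Monoid.Coprod.inr n) = 1 := rfl

/-- Extension of a cocycle to the big groups. -/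
def extend (b : Λ₀ →* Equiv.Perm X) (α : Λ₀ → X → Γ₀)
    (hα : ∀ l m x, α (l * m) x = α l (b m x) * α m x) : Big Λ₀ →* Skew X (Big Γ₀) :=
  Monoid.Coprod.lift
    (MonoidHom.mk' (fun p => ⟨b p.1, fun x => Monoid.Coprod.inl (α p.1 x, p.2)⟩) (by
      intro p q
      refine Skew.ext' (by simp) fun x => ?_
      simp only [Skew.mul_coc, ← map_mul, Prod.mk_mul_mk, Prod.fst_mul, Prod.snd_mul, hα]))
    (MonoidHom.mk' (fun n => ⟨1, fun _ => Monoid.Coprod.inr n⟩) (by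
      intro p q
      refine Skew.ext' (by simp) fun x => ?_
      simp))

variable (b : Λ₀ →* Equiv.Perm X) (α : Λ₀ → X → Γ₀)
    (hα : ∀ l m x, α (l * m) x = α l (b m x) * α m x)

lemma extend_inl (p : Λ₀ × FreeGroup (Fin 2)) :
    extend b α hα (Monoid.Coprod.inl p) = ⟨b p.1, fun x => Monoid.Coprod.inl (α p.1 x, p.2)⟩ := rfl

lemma extend_inr (n : Multiplicative ℤ) :
    extend b α hα (Monoid.Coprod.inr n) = ⟨1, fun _ => Monoid.Coprod.inr n⟩ := rfl

lemma extend_base (h : Big Λ₀) : (extend b α hα h).base = b (proj Λ₀ h) := by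
  induction h using Monoid.Coprod.induction_on with
  | inl p => rfl
  | inr n => simp [extend_inr]
  | mul x y hx hy => simp [hx, hy]

lemma extend_meas [Countable Γ₀] [MeasurableSpace X] (hb : ∀ l, Measurable (b l))
    (hm : ∀ l c, MeasurableSet {x | α l x = c}) (h : Big Λ₀) :
    ∀ g, MeasurableSet {x | (extend b α hα h).coc x = g} := by
  induction h using Monoid.Coprod.induction_on with
  | inl p =>
    intro g
    rw [extend_inl]
    have : {x | (Monoid.Coprod.inl (α p.1 x, p.2) : Big Γ₀) = g} =
        ⋃ c : Γ₀, {x | α p.1 x = c} ∩ {_x | (Monoid.Coprod.inl (c, p.2) : Big Γ₀) = g} := by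
      ext x; simp
    show MeasurableSet {x | (Monoid.Coprod.inl (α p.1 x, p.2) : Big Γ₀) = g}
    rw [this]
    exact MeasurableSet.iUnion fun c => (hm _ _).inter (MeasurableSet.const _)
  | inr n =>
    intro g
    exact MeasurableSet.const ((Monoid.Coprod.inr n : Big Γ₀) = g)
  | mul h k hh hk =>
    intro g
    have : {x | (extend b α hα (h * k)).coc x = g} =
        ⋃ c : Big Γ₀, {x | (extend b α hα k).coc x = c} ∩
          b (proj Λ₀ k) ⁻¹' {x | (extend b α hα h).coc x = g * c⁻¹} := by
      ext x; simp [extend_base, eq_mul_inv_iff_mul_eq]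
    rw [this]
    exact MeasurableSet.iUnion fun c => (hk _).inter (hb _ (hh _))

lemma extend_inverse (a : Γ₀ →* Equiv.Perm X) (β : Γ₀ → X → Λ₀)
    (hβ : ∀ l m x, β (l * m) x = β l (a m x) * β m x) (X₀ : Set X)
    (hX : ∀ l, ∀ x ∈ X₀, b l x ∈ X₀)
    (h1 : ∀ l, ∀ x ∈ X₀, β (α l x) x = l) (h2 : ∀ l, ∀ x ∈ X₀, a (α l x) x = b l x) (h : Big Λ₀) :
    ∀ x ∈ X₀, (extend a β hβ ((extend b α hα h).coc x)).coc x = h ∧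
      a (proj Γ₀ ((extend b α hα h).coc x)) x = b (proj Λ₀ h) x := by
  induction h using Monoid.Coprod.induction_on with
  | inl p =>
    intro x hx
    simp [extend_inl, h1 _ x hx, h2 _ x hx]
  | inr n =>
    intro x hx
    simp [extend_inr]
  | mul h k hh hk =>
    intro x hx
    obtain ⟨k1, k2⟩ := hk x hx
    obtain ⟨l1, l2⟩ := hh _ (hX (proj Λ₀ k) x hx)
    simp [extend_base, k1, k2, l1, l2]

end ext

section good
variable {X Γ₀ Λ₀ : Type} [Group Γ₀] [Group Λ₀] (a : Γ₀ →* Equiv.Perm X) (b : Λ₀ →* Equiv.Perm X)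

/-- The points where everything is fine. -/
def good : Set X :=
  {x | orbitOf a x = orbitOf b x ∧ (∀ g, g ≠ 1 → a g x ≠ x) ∧ (∀ l, l ≠ 1 → b l x ≠ x)}

lemma good_comm : good a b = good b a := by
  ext x
  simp only [good, Set.mem_ofPred_eq, eq_comm (a := orbitOf a x)]
  tauto

lemma orbitOf_apply (g : Γ₀) (x : X) : orbitOf a (a g x) = orbitOf a x := by
  ext y
  constructor
  · rintro ⟨k, rfl⟩
    exact ⟨k * g, by simp⟩
  · rintro ⟨k, rfl⟩
    exact ⟨k * g⁻¹, by simp⟩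

variable {a b}

lemma good_unique {x : X} (hx : x ∈ good a b) {g k : Γ₀} (h : a g x = a k x) : g = k := by
  by_contra hne
  refine hx.2.1 (k⁻¹ * g) (fun h1 => hne ?_) ?_
  · exact (inv_mul_eq_one.1 h1).symm
  · simp [h]

lemma free_apply {g : Γ₀} {x : X} (hx : ∀ k, k ≠ 1 → a k x ≠ x) :
    ∀ k, k ≠ 1 → a k (a g x) ≠ a g x := by
  intro k hk h
  refine hx (g⁻¹ * k * g) (fun h1 => hk ?_) ?_
  · have : k = g * (g⁻¹ * k * g) * g⁻¹ := by group
    rw [this, h1]; group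
  · simp [h]

lemma good_apply {x : X} (hx : x ∈ good a b) (l : Λ₀) : b l x ∈ good a b := by
  have h1 : b l x ∈ orbitOf a x := by rw [hx.1]; exact ⟨l, rfl⟩
  obtain ⟨g, hg⟩ := h1
  have hg' : a g x = b l x := hg
  refine ⟨?_, ?_, free_apply hx.2.2⟩
  · rw [orbitOf_apply, ← hg', orbitOf_apply]; exact hx.1
  · rw [← hg']; exact free_apply hx.2.1

lemma good_of_apply {x : X} {l : Λ₀} (hx : b l x ∈ good a b) : x ∈ good a b := by
  have := good_apply hx l⁻¹
  simpa using this

lemma good_exists {x : X} (hx : x ∈ good a b) (l : Λ₀) : ∃ g, a g x = b l x := by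
  have h1 : b l x ∈ orbitOf a x := by rw [hx.1]; exact ⟨l, rfl⟩
  exact h1

variable (a b)

open Classical in
/-- The orbit cocycle. -/
noncomputable def alpha (l : Λ₀) (x : X) : Γ₀ :=
  if h : x ∈ good a b then (good_exists h l).choose else 1

variable {a b}

lemma alpha_spec {x : X} (hx : x ∈ good a b) (l : Λ₀) : a (alpha a b l x) x = b l x := by
  rw [alpha, dif_pos hx]; exact (good_exists hx l).choose_spec

lemma alpha_bad {x : X} (hx : x ∉ good a b) (l : Λ₀) : alpha a b l x = 1 := by
  rw [alpha, dif_neg hx]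

lemma alpha_cocycle (l m : Λ₀) (x : X) :
    alpha a b (l * m) x = alpha a b l (b m x) * alpha a b m x := by
  by_cases hx : x ∈ good a b
  · apply good_unique hx
    rw [alpha_spec hx, map_mul, map_mul, Equiv.Perm.mul_apply, Equiv.Perm.mul_apply, alpha_spec hx,
      alpha_spec (good_apply hx m)]
  · rw [alpha_bad hx, alpha_bad hx, alpha_bad (fun h => hx (good_of_apply h)), one_mul]

lemma alpha_alpha {x : X} (hx : x ∈ good a b) (l : Λ₀) : alpha b a (alpha a b l x) x = l := by
  have hx' : x ∈ good b a := by rwa [good_comm]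
  apply good_unique hx'
  rw [alpha_spec hx', alpha_spec hx]

variable [MeasurableSpace X] [StandardBorelSpace X] [Countable Γ₀] [Countable Λ₀]

lemma good_meas (ha : ∀ g, Measurable (a g)) (hb : ∀ l, Measurable (b l)) :
    MeasurableSet (good a b) := by
  have : good a b = ((⋂ g, ⋃ l, {x | b l x = a g x}) ∩ (⋂ l, ⋃ g, {x | a g x = b l x})) ∩
      ((⋂ g, ⋂ (_ : g ≠ 1), {x | a g x = x}ᶜ) ∩ (⋂ l, ⋂ (_ : l ≠ 1), {x | b l x = x}ᶜ)) := by
    ext x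
    simp only [good, orbitOf, Set.mem_ofPred_eq, Set.mem_inter_iff, Set.mem_iInter, Set.mem_iUnion,
      Set.mem_compl_iff]
    rw [Set.Subset.antisymm_iff, Set.range_subset_iff, Set.range_subset_iff]
    simp only [Set.mem_range]
  rw [this]
  refine ((MeasurableSet.iInter fun g => MeasurableSet.iUnion fun l =>
      measurableSet_eq_fun (hb l) (ha g)).inter
    (MeasurableSet.iInter fun g => MeasurableSet.iUnion fun l =>
      measurableSet_eq_fun (ha l) (hb g))).inter
    ((MeasurableSet.iInter fun g => MeasurableSet.iInter fun _ =>
      (measurableSet_eq_fun (ha g) measurable_id).compl).inter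
    (MeasurableSet.iInter fun g => MeasurableSet.iInter fun _ =>
      (measurableSet_eq_fun (hb g) measurable_id).compl))

lemma alpha_meas (ha : ∀ g, Measurable (a g)) (hb : ∀ l, Measurable (b l)) (l : Λ₀) (c : Γ₀) :
    MeasurableSet {x | alpha a b l x = c} := by
  have : {x | alpha a b l x = c} = (good a b ∩ {x | a c x = b l x}) ∪
      ((good a b)ᶜ ∩ {_x | 1 = c}) := by
    ext x
    by_cases hx : x ∈ good a b
    · simp only [Set.mem_ofPred_eq, Set.mem_union, Set.mem_inter_iff, hx, true_and,
        Set.mem_compl_iff, not_true, false_and, or_false]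
      constructor
      · rintro rfl; exact alpha_spec hx l
      · intro h; exact good_unique hx ((alpha_spec hx l).trans h.symm)
    · simp [hx, alpha_bad hx]
  rw [this]
  exact ((good_meas ha hb).inter (measurableSet_eq_fun (ha c) (hb l))).union
    ((good_meas ha hb).compl.inter (MeasurableSet.const _))

end good

/-- The direct skew action of the big group on its own Bernoulli space. -/
def direct {X Γ₀ : Type} [Group Γ₀] (a : Γ₀ →* Equiv.Perm X) : Big Γ₀ →* Skew X (Big Γ₀) :=
  MonoidHom.mk' (fun g => ⟨a (proj Γ₀ g), fun _ => g⟩)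
    (fun g h => Skew.ext' (by simp) fun x => by simp)

lemma inr_pow_ne {Γ₀ : Type} [Group Γ₀] (n : ℕ) (hn : n ≠ 0) :
    (Monoid.Coprod.inr (Multiplicative.ofAdd (1 : ℤ)) : Big Γ₀) ^ n ≠ 1 := by
  intro h
  have := congrArg Monoid.Coprod.snd h
  rw [map_pow, Monoid.Coprod.snd_apply_inr, ← ofAdd_nsmul, map_one Monoid.Coprod.snd] at this
  have h2 : n • (1 : ℤ) = 0 := this
  simp at h2
  exact hn h2

end OEProof

/-- Orbit equivalence is preserved by the construction `Γ₀ ↦ (Γ₀ × F₂) ∗ ℤ`. -/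
theorem orbitEquivalent_prodFreeGroupCoprodInt
    (Γ₀ Λ₀ : Type) [Group Γ₀] [Group Λ₀] [Countable Γ₀] [Countable Λ₀]
    (X : Type) [MeasurableSpace X] [StandardBorelSpace X]
    (μ : Measure X) [IsProbabilityMeasure μ]
    (a : Γ₀ →* Equiv.Perm X) (b : Λ₀ →* Equiv.Perm X)
    (ha₁ : IsPMPAction μ a) (ha₂ : IsFreeAction μ a) (ha₃ : IsErgodicAction μ a)
    (hb₁ : IsPMPAction μ b) (hb₂ : IsFreeAction μ b) (hb₃ : IsErgodicAction μ b)
    (horb : ∀ᵐ x ∂μ, orbitOf a x = orbitOf b x) :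
    AreOrbitEquivalent (Monoid.Coprod (Γ₀ × FreeGroup (Fin 2)) (Multiplicative ℤ))
      (Monoid.Coprod (Λ₀ × FreeGroup (Fin 2)) (Multiplicative ℤ)) := by
  have hgood : ∀ᵐ x ∂μ, x ∈ OEProof.good a b := by
    have f1 : ∀ᵐ x ∂μ, ∀ g, g ≠ 1 → a g x ≠ x := by
      rw [ae_all_iff]
      intro g
      by_cases hg : g = 1
      · simp [hg]
      · have := ha₂ g hg
        rw [ae_iff]
        simpa [hg] using this
    have f2 : ∀ᵐ x ∂μ, ∀ g, g ≠ 1 → b g x ≠ x := by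
      rw [ae_all_iff]
      intro g
      by_cases hg : g = 1
      · simp [hg]
      · have := hb₂ g hg
        rw [ae_iff]
        simpa [hg] using this
    filter_upwards [horb, f1, f2] with x h1 h2 h3
    exact ⟨h1, h2, h3⟩
  have ham : ∀ g, Measurable (a g) := fun g => (ha₁ g).measurable
  have hbm : ∀ g, Measurable (b g) := fun g => (hb₁ g).measurable
  let Ψ := OEProof.direct a
  let Φ := OEProof.extend b (OEProof.alpha a b) OEProof.alpha_cocycle
  have inv1 := OEProof.extend_inverse b (OEProof.alpha a b) OEProof.alpha_cocycle a
    (OEProof.alpha b a) OEProof.alpha_cocycle (OEProof.good a b)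
    (fun l x hx => OEProof.good_apply hx l) (fun l x hx => OEProof.alpha_alpha hx l)
    (fun l x hx => OEProof.alpha_spec hx l)
  have inv2 := OEProof.extend_inverse a (OEProof.alpha b a) OEProof.alpha_cocycle b
    (OEProof.alpha a b) OEProof.alpha_cocycle (OEProof.good b a)
    (fun l x hx => OEProof.good_apply hx l) (fun l x hx => OEProof.alpha_alpha hx l)
    (fun l x hx => OEProof.alpha_spec hx l)
  have hΨb : ∀ h, MeasurePreserving (Ψ h).base μ μ := fun h => ha₁ _
  have hΦb : ∀ h, MeasurePreserving (Φ h).base μ μ := fun h => by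
    rw [OEProof.extend_base]; exact hb₁ _
  have hΨc : ∀ h g, MeasurableSet {x | (Ψ h).coc x = g} := fun h g => MeasurableSet.const (h = g)
  have hΦc : ∀ h g, MeasurableSet {x | (Φ h).coc x = g} :=
    OEProof.extend_meas b _ _ hbm (OEProof.alpha_meas ham hbm)
  refine ⟨X × (OEProof.Big Γ₀ → ℝ), inferInstance, μ.prod (OEProof.bern _), inferInstance,
    inferInstance, OEProof.skAct Ψ, OEProof.skAct Φ,
    OEProof.skAct_pmp μ Ψ hΨb hΨc,
    OEProof.skAct_free μ Ψ (fun h => (hΨb h).measurable) hΨc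
      (Filter.Eventually.of_forall fun x h hh => hh),
    OEProof.skAct_ergodic μ Ψ ?_ (Monoid.Coprod.inr (Multiplicative.ofAdd (1 : ℤ)))
      _ OEProof.inr_pow_ne (map_one a) (fun _ => rfl),
    OEProof.skAct_pmp μ Φ hΦb hΦc,
    OEProof.skAct_free μ Φ (fun h => (hΦb h).measurable) hΦc ?_,
    OEProof.skAct_ergodic μ Φ ?_ (Monoid.Coprod.inr (Multiplicative.ofAdd (1 : ℤ)))
      _ OEProof.inr_pow_ne rfl (fun _ => rfl), ?_⟩
  · intro A hA h
    exact ha₃ A hA fun g => h (Monoid.Coprod.inl (g, 1))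
  · filter_upwards [hgood] with x hx h hh hc
    apply hh
    have h1 := (inv1 h x hx).1
    have hc' : (OEProof.extend b (OEProof.alpha a b) OEProof.alpha_cocycle h).coc x = 1 := hc
    rw [hc', map_one] at h1
    exact h1.symm
  · intro A hA h
    exact hb₃ A hA fun g => h (Monoid.Coprod.inl (g, 1))
  · have h1 : ∀ᵐ p ∂(μ.prod (OEProof.bern (OEProof.Big Γ₀))), p.1 ∈ OEProof.good a b :=
      Measure.quasiMeasurePreserving_fst.ae hgood
    filter_upwards [h1] with p hp
    have hp' : p.1 ∈ OEProof.good b a := by rwa [OEProof.good_comm]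
    apply Set.Subset.antisymm
    · rintro _ ⟨g, rfl⟩
      obtain ⟨e1, e2⟩ := inv2 g p.1 hp'
      refine ⟨(OEProof.extend a (OEProof.alpha b a) OEProof.alpha_cocycle g).coc p.1,
        Prod.ext ?_ ?_⟩
      · show (Φ _).base p.1 = a (OEProof.proj Γ₀ g) p.1
        rw [OEProof.extend_base, e2]
      · show OEProof.sh _ ((Φ _).coc p.1) p.2 = OEProof.sh _ g p.2
        rw [e1]
    · rintro _ ⟨h, rfl⟩
      obtain ⟨e1, e2⟩ := inv1 h p.1 hp
      refine ⟨(Φ h).coc p.1, Prod.ext ?_ rfl⟩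
      show a (OEProof.proj Γ₀ _) p.1 = (Φ h).base p.1
      rw [OEProof.extend_base, e2]
end

section
/- Let S∞ be the group of finitary permutations of ℕ, let Γ = (S∞ × F₂) ∗ ℤ and Λ = (ℤ × F₂) ∗ ℤ. Then Γ and Λ are both countable ICC groups and they are orbit equivalent: there exist a standard Borel probability space (X, μ) and free, ergodic, probability-measure-preserving actions of Γ and Λ on X whose orbits agree μ-almost everywhere. -/
open MeasureTheory

/-- A group is ICC if every nonidentity element has an infinite conjugacy class. -/
def IsICCGroup (G : Type*) [Group G] : Prop :=
  ∀ g : G, g ≠ 1 → (Set.range fun h : G => h * g * h⁻¹).Infinite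

/-- The group of finitary permutations of ℕ. -/
def SInf : Subgroup (Equiv.Perm ℕ) where
  carrier := {σ | {n | σ n ≠ n}.Finite}
  one_mem' := by simp
  mul_mem' := by
    intro σ τ hσ hτ
    refine Set.Finite.subset ((hσ.preimage τ.injective.injOn).union hτ) ?_
    intro n hn
    by_contra h
    simp only [Set.mem_union, Set.mem_preimage, Set.mem_setOf_eq, not_or, not_not] at h
    refine hn ?_
    show σ (τ n) = n
    rw [h.2, ← h.2]
    exact h.1
  inv_mem' := by
    intro σ hσ
    have : {n | σ⁻¹ n ≠ n} = {n | σ n ≠ n} := by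
      ext n
      simp only [Set.mem_setOf_eq, ne_eq, Equiv.Perm.inv_eq_iff_eq]
      exact not_iff_not.mpr eq_comm
    show {n | σ⁻¹ n ≠ n}.Finite
    exact this ▸ hσ

section ICC
open Monoid

theorem icc_coprodI {ι : Type*} [Nontrivial ι] (G : ι → Type*) [∀ i, Group (G i)]
    [∀ i, Infinite (G i)] : IsICCGroup (CoprodI G) := by
  classical
  intro g hg
  have hprodinj : ∀ w₁ w₂ : CoprodI.Word G, w₁.prod = w₂.prod → w₁ = w₂ := fun w₁ w₂ h =>
    CoprodI.Word.equiv.symm.injective h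
  obtain ⟨i, j, w, hw⟩ := CoprodI.NeWord.of_word (CoprodI.Word.equiv g) (by
    intro h
    apply hg
    have := congrArg CoprodI.Word.prod h
    rw [CoprodI.Word.prod_empty] at this
    rw [← this]
    exact (CoprodI.Word.equiv.symm_apply_apply g).symm)
  have hwg : w.prod = g := by
    rw [CoprodI.NeWord.prod, hw]
    exact CoprodI.Word.equiv.symm_apply_apply g
  by_cases hij : i = j
  · subst hij
    obtain ⟨k, hk⟩ := exists_ne i
    have hinf : ({1}ᶜ : Set (G k)).Infinite := (Set.finite_singleton 1).infinite_compl
    refine Set.infinite_of_injOn_mapsTo (f := fun x : G k =>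
      CoprodI.of x * g * (CoprodI.of x)⁻¹) ?_ (fun x _ => ⟨CoprodI.of x, rfl⟩) hinf
    have key : ∀ x : G k, x ≠ 1 → ∃ v : CoprodI.NeWord G k k,
        v.prod = CoprodI.of x * g * (CoprodI.of x)⁻¹ ∧ v.head = x := fun x hx =>
      ⟨((CoprodI.NeWord.singleton x hx).append hk w).append hk.symm
        (CoprodI.NeWord.singleton x⁻¹ (inv_ne_one.mpr hx)), by simp [hwg], by simp⟩
    intro x hx y hy hxy
    obtain ⟨v, hv, hvx⟩ := key x hx
    obtain ⟨u, hu, huy⟩ := key y hy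
    have h1 : v.toWord = u.toWord := hprodinj _ _ (by
      change v.prod = u.prod
      rw [hv, hu]; exact hxy)
    have h2 : v.toList = u.toList := congrArg CoprodI.Word.toList h1
    have h3 := v.toList_head?
    rw [h2, u.toList_head?, hvx, huy] at h3
    simpa using h3.symm
  · have hinf : ({1, w.head⁻¹}ᶜ : Set (G i)).Infinite := (Set.toFinite _).infinite_compl
    refine Set.infinite_of_injOn_mapsTo (f := fun x : G i =>
      CoprodI.of x * g * (CoprodI.of x)⁻¹) ?_ (fun x _ => ⟨CoprodI.of x, rfl⟩) hinf
    have key : ∀ x : G i, x ∈ ({1, w.head⁻¹}ᶜ : Set (G i)) → ∃ v : CoprodI.NeWord G i i,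
        v.prod = CoprodI.of x * g * (CoprodI.of x)⁻¹ ∧ v.last = x⁻¹ := fun x hx => by
      simp only [Set.mem_compl_iff, Set.mem_insert_iff, Set.mem_singleton_iff, not_or] at hx
      refine ⟨(w.mulHead x (fun h => hx.2 (eq_inv_of_mul_eq_one_left h))).append (Ne.symm hij)
        (CoprodI.NeWord.singleton x⁻¹ (inv_ne_one.mpr hx.1)), by simp [hwg], by simp⟩
    intro x hx y hy hxy
    obtain ⟨v, hv, hvx⟩ := key x hx
    obtain ⟨u, hu, huy⟩ := key y hy
    have h1 : v.toWord = u.toWord := hprodinj _ _ (by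
      change v.prod = u.prod
      rw [hv, hu]; exact hxy)
    have h2 : v.toList = u.toList := congrArg CoprodI.Word.toList h1
    have h3 := v.toList_getLast?
    rw [h2, u.toList_getLast?, hvx, huy] at h3
    simpa using h3.symm

/-- Two-element family of groups. -/
@[reducible] def famBool (A B : Type) : Bool → Type := fun b => cond b A B

instance famGroup (A B : Type) [Group A] [Group B] : ∀ b, Group (famBool A B b)
  | true => inferInstanceAs (Group A)
  | false => inferInstanceAs (Group B)

instance famInf (A B : Type) [Infinite A] [Infinite B] : ∀ b, Infinite (famBool A B b)
  | true => inferInstanceAs (Infinite A)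
  | false => inferInstanceAs (Infinite B)

/-- The homs from the family. -/
def famHom (A B : Type) [Group A] [Group B] : ∀ b, famBool A B b →* Coprod A B
  | true => (Coprod.inl : A →* Coprod A B)
  | false => (Coprod.inr : B →* Coprod A B)

/-- Binary coproduct as indexed coproduct. -/
def coprodEquiv (A B : Type) [Group A] [Group B] :
    CoprodI (famBool A B) ≃* Coprod A B :=
  MonoidHom.toMulEquiv (CoprodI.lift (famHom A B))
    (Coprod.lift (CoprodI.of (M := famBool A B) (i := true))
      (CoprodI.of (M := famBool A B) (i := false)))
    (by
      apply CoprodI.ext_hom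
      rintro (_ | _) <;> ext x <;> simp [famHom] <;> rfl)
    (by
      apply Coprod.hom_ext <;> ext x <;> simp <;> rfl)

theorem icc_of_equiv {G H : Type*} [Group G] [Group H] (e : G ≃* H) (h : IsICCGroup G) :
    IsICCGroup H := by
  intro g hg
  have := h (e.symm g) (by simpa using hg)
  refine Set.infinite_of_injOn_mapsTo (f := e) e.injective.injOn ?_ this
  rintro _ ⟨x, rfl⟩
  exact ⟨e x, by simp⟩

theorem icc_coprod (A B : Type) [Group A] [Group B] [Infinite A] [Infinite B] :
    IsICCGroup (Coprod A B) :=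
  icc_of_equiv (coprodEquiv A B) (icc_coprodI _)

instance countable_coprod (A B : Type) [Group A] [Group B] [Countable A] [Countable B] :
    Countable (Coprod A B) := by
  have : Countable (FreeMonoid (A ⊕ B)) := inferInstanceAs (Countable (List (A ⊕ B)))
  exact Coprod.mk_surjective.countable

instance countable_SInf : Countable SInf := by
  have hf : ∀ s : SInf, {p : ℕ × ℕ | s.1 p.1 ≠ p.1 ∧ p.2 = s.1 p.1}.Finite := fun s => by
    refine (Set.Finite.image (fun n => (n, s.1 n)) s.2).subset ?_
    rintro ⟨a, b⟩ ⟨h1, h2⟩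
    exact ⟨a, h1, by simp at h2; simp [h2]⟩
  apply Function.Injective.countable (f := fun s : SInf => (hf s).toFinset)
  intro s t hst
  have h : ∀ p : ℕ × ℕ, (s.1 p.1 ≠ p.1 ∧ p.2 = s.1 p.1) ↔ (t.1 p.1 ≠ p.1 ∧ p.2 = t.1 p.1) := by
    intro p
    have := Finset.ext_iff.mp hst p
    simpa using this
  apply Subtype.ext
  ext n
  by_cases hs : s.1 n = n
  · by_cases ht : t.1 n = n
    · rw [hs, ht]
    · have := (h (n, t.1 n)).mpr ⟨ht, rfl⟩
      exact absurd hs this.1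
  · exact ((h (n, s.1 n)).mp ⟨hs, rfl⟩).2

end ICC

section Bern
open Measure ProbabilityTheory

/-- Elements of the full group preserve the measure. -/
theorem mp_of_full {X ι : Type*} [MeasurableSpace X] [Countable ι] (μ : Measure X)
    (m : ι → Equiv.Perm X) (hm : ∀ i, MeasurePreserving (m i) μ μ)
    (hm' : ∀ i, Measurable (m i).symm) (f : Equiv.Perm X) (c : X → ι)
    (hc : ∀ i, MeasurableSet {x | c x = i}) (hf : ∀ x, f x = m (c x) x) :
    MeasurePreserving f μ μ := by
  have hpre : ∀ S : Set X, f ⁻¹' S = ⋃ i, ({x | c x = i} ∩ m i ⁻¹' S) := by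
    intro S
    ext x
    simp [hf]
  have hmeas : Measurable f := by
    intro S hS
    rw [hpre]
    exact MeasurableSet.iUnion fun i => (hc i).inter ((hm i).measurable hS)
  refine ⟨hmeas, ?_⟩
  ext S hS
  rw [Measure.map_apply hmeas hS, hpre, measure_iUnion]
  · have h1 : ∀ i, {x | c x = i} ∩ m i ⁻¹' S = m i ⁻¹' (((m i).symm ⁻¹' {x | c x = i}) ∩ S) := by
      intro i
      ext x
      simp
    have h2 : ∀ i, μ ({x | c x = i} ∩ m i ⁻¹' S) = μ (((m i).symm ⁻¹' {x | c x = i}) ∩ S) := by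
      intro i
      rw [h1, (hm i).measure_preimage (((hm' i) (hc i)).inter hS).nullMeasurableSet]
    simp_rw [h2]
    rw [← measure_iUnion]
    · congr 1
      ext x
      simp only [Set.mem_iUnion, Set.mem_inter_iff, Set.mem_preimage, exists_and_right,
        and_iff_right_iff_imp]
      intro _
      refine ⟨c (f.symm x), ?_⟩
      have h3 : m (c (f.symm x)) (f.symm x) = x := by rw [← hf]; simp
      have h4 : (m (c (f.symm x))).symm x = f.symm x := by
        rw [Equiv.symm_apply_eq, h3]
      change c ((m (c (f.symm x))).symm x) = _
      rw [h4]
    · intro i j hij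
      rw [Function.onFun, Set.disjoint_left]
      rintro x ⟨hi, _⟩ ⟨hj, _⟩
      change c ((m i).symm x) = i at hi
      change c ((m j).symm x) = j at hj
      have hi' : f ((m i).symm x) = x := by rw [hf, hi]; simp
      have hj' : f ((m j).symm x) = x := by rw [hf, hj]; simp
      have := f.injective (hi'.trans hj'.symm)
      rw [this] at hi
      exact hij (hi.symm.trans hj)
    · intro i
      exact ((hm' i) (hc i)).inter hS
  · intro i j hij
    rw [Function.onFun, Set.disjoint_left]
    rintro x ⟨hi, _⟩ ⟨hj, _⟩
    exact hij (hi.symm.trans hj)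
  · intro i
    exact (hc i).inter ((hm i).measurable hS)

/-- Version for actions. -/
theorem mp_of_full_action {X G : Type*} [MeasurableSpace X] [Group G] [Countable G]
    (μ : Measure X) (a : G →* Equiv.Perm X) (ha : IsPMPAction μ a) (f : Equiv.Perm X) (c : X → G)
    (hc : ∀ i, MeasurableSet {x | c x = i}) (hf : ∀ x, f x = a (c x) x) :
    MeasurePreserving f μ μ :=
  mp_of_full μ (fun g => a g) ha (fun g => by
    have := (ha g⁻¹).measurable
    rw [map_inv] at this
    exact this) f c hc hf

variable (G : Type) [Group G]

/-- The Bernoulli action. -/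
def bern : G →* Equiv.Perm (G → unitInterval) where
  toFun g :=
    { toFun := fun k h => k (g⁻¹ * h)
      invFun := fun k h => k (g * h)
      left_inv := fun k => by ext h; simp
      right_inv := fun k => by ext h; simp }
  map_one' := by ext k h; simp
  map_mul' g g' := by ext k h; simp [mul_assoc]

/-- The Bernoulli measure. -/
noncomputable def bernM : Measure (G → unitInterval) :=
  infinitePi (fun _ : G => (volume : Measure unitInterval))

instance : IsProbabilityMeasure (bernM G) := by unfold bernM; infer_instance

theorem bern_pmp : IsPMPAction (bernM G) (bern G) := by
  intro g
  refine ⟨measurable_pi_lambda _ fun h => measurable_pi_apply _, ?_⟩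
  exact map_infinitePi_infinitePi_of_inj (P := fun _ : G => (volume : Measure unitInterval))
    (f := fun h => g⁻¹ * h) (mul_right_injective g⁻¹)

theorem bern_free : IsFreeAction (bernM G) (bern G) := by
  intro g hg
  have h1 : {k | bern G g k = k} ⊆ (fun k : G → unitInterval => (k g⁻¹, k 1)) ⁻¹'
      {p | p.1 = p.2} := by
    intro k hk
    have := congrFun hk 1
    simpa [bern] using this
  refine measure_mono_null h1 ?_
  have hm : Measurable (fun k : G → unitInterval => (k g⁻¹, k 1)) := by fun_prop
  have hd : MeasurableSet {p : unitInterval × unitInterval | p.1 = p.2} :=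
    measurableSet_eq_fun measurable_fst measurable_snd
  rw [← Measure.map_apply hm hd, bernM, infinitePi_map_eval_prod (by simpa using hg),
    Measure.measure_prod_null hd]
  refine Filter.Eventually.of_forall fun x => ?_
  have : Prod.mk x ⁻¹' {p : unitInterval × unitInterval | p.1 = p.2} = {x} := by
    ext y; simp [eq_comm]
  change volume (Prod.mk x ⁻¹' {p : unitInterval × unitInterval | p.1 = p.2}) = 0
  rw [this]; simp

theorem bern_erg (t : G) (ht : Function.Injective fun n : ℕ => t ^ n)
    (A : Set (G → unitInterval)) (hA : MeasurableSet A)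
    (hinv : bern G t ⁻¹' A = A) : bernM G A = 0 ∨ bernM G A = 1 := by
  classical
  have hinvn : ∀ n : ℕ, bern G (t ^ n) ⁻¹' A = A := by
    intro n
    induction n with
    | zero => simp
    | succ n ih =>
      rw [pow_succ, map_mul]
      have : (⇑(bern G (t ^ n) * bern G t)) ⁻¹' A = bern G t ⁻¹' (bern G (t ^ n) ⁻¹' A) := rfl
      rw [this, ih, hinv]
  set μ := bernM G with hμ
  have key : ∀ ε : ℝ, 0 < ε → |μ.real A - μ.real A * μ.real A| ≤ 4 * ε := by
    intro ε hε
    obtain ⟨B, hB, hBA⟩ := exists_measure_symmDiff_lt_of_generateFrom_isSetRing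
      (μ := μ) (isSetRing_measurableCylinders (α := fun _ : G => unitInterval))
      ⟨{Set.univ}, by simp, Set.singleton_subset_iff.mpr (univ_mem_measurableCylinders _), by simp⟩
      generateFrom_measurableCylinders.symm hA (ε := ENNReal.ofReal ε) (by simpa using hε)
    obtain ⟨F, S, hS, rfl⟩ := (mem_measurableCylinders _).mp hB
    set B := cylinder (α := fun _ : G => unitInterval) F S with hBdef
    have hBm : MeasurableSet B := MeasurableSet.cylinder _ hS
    have hBA' : μ.real (symmDiff B A) < ε := by
      rw [measureReal_def]
      exact (ENNReal.lt_ofReal_iff_toReal_lt (measure_ne_top _ _)).mp hBA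
    -- choose n
    obtain ⟨n, hn⟩ : ∃ n : ℕ, Disjoint F (F.image fun h => (t ^ n)⁻¹ * h) := by
      have hfin : {n : ℕ | t ^ n ∈ (F ×ˢ F).image fun p => p.2 * p.1⁻¹}.Finite :=
        Set.Finite.preimage ht.injOn (Finset.finite_toSet _)
      obtain ⟨n, hn⟩ := hfin.exists_notMem
      refine ⟨n, ?_⟩
      rw [Finset.disjoint_left]
      intro x hx hx'
      obtain ⟨y, hy, rfl⟩ := Finset.mem_image.mp hx'
      apply hn
      refine Finset.mem_image.mpr ⟨(_, _), Finset.mem_product.mpr ⟨hx, hy⟩, ?_⟩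
      simp
    set f := bern G (t ^ n) with hf
    have hfmp : MeasurePreserving f μ μ := bern_pmp G _
    have hind : μ.real (B ∩ f ⁻¹' B) = μ.real B * μ.real B := by
      have hi := iIndepFun_infinitePi (P := fun _ : G => (volume : Measure unitInterval))
        (X := fun _ x => x) (fun _ => measurable_id)
      have hi2 := hi.indepFun_finset F (F.image fun h => (t ^ n)⁻¹ * h) hn
        (fun i => measurable_pi_apply i)
      let S' : Set ((F.image fun h => (t ^ n)⁻¹ * h : Finset G) → unitInterval) :=
        (fun v (i : F) => v ⟨(t ^ n)⁻¹ * i, Finset.mem_image_of_mem _ i.2⟩) ⁻¹' S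
      have hS' : MeasurableSet S' :=
        (measurable_pi_lambda _ fun i => measurable_pi_apply _) hS
      have := hi2.measure_inter_preimage_eq_mul S S' hS hS'
      have e1 : (fun (a : G → unitInterval) (i : F) => a i) ⁻¹' S = B := rfl
      have e2 : (fun (a : G → unitInterval)
          (i : (F.image fun h => (t ^ n)⁻¹ * h : Finset G)) => a i) ⁻¹' S' = f ⁻¹' B := rfl
      rw [e1, e2] at this
      change μ (B ∩ f ⁻¹' B) = μ B * μ (f ⁻¹' B) at this
      rw [hfmp.measure_preimage hBm.nullMeasurableSet] at this
      simp only [measureReal_def, this, ENNReal.toReal_mul]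
    have h1 : |μ.real B - μ.real A| ≤ ε :=
      (abs_measureReal_sub_le_measureReal_symmDiff hBm.nullMeasurableSet
        hA.nullMeasurableSet).trans hBA'.le
    have h2 : |μ.real (B ∩ f ⁻¹' B) - μ.real A| ≤ 2 * ε := by
      refine (abs_measureReal_sub_le_measureReal_symmDiff
        (hBm.inter (hfmp.measurable hBm)).nullMeasurableSet hA.nullMeasurableSet).trans ?_
      have hsub : symmDiff (B ∩ f ⁻¹' B) A ⊆ symmDiff B A ∪ f ⁻¹' (symmDiff B A) := by
        have hAx : ∀ x, f x ∈ A ↔ x ∈ A := fun x => by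
          have := Set.ext_iff.mp (hinvn n) x
          exact this
        intro x hx
        have := hAx x
        simp only [Set.mem_symmDiff, Set.mem_inter_iff, Set.mem_preimage, Set.mem_union] at hx ⊢
        tauto
      have h3 : μ.real (f ⁻¹' (symmDiff B A)) = μ.real (symmDiff B A) := by
        simp only [measureReal_def]
        rw [hfmp.measure_preimage (hBm.symmDiff hA).nullMeasurableSet]
      calc _ ≤ μ.real (symmDiff B A ∪ f ⁻¹' (symmDiff B A)) := measureReal_mono hsub
        _ ≤ _ := measureReal_union_le _ _
        _ ≤ 2 * ε := by rw [h3]; linarith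
    rw [hind] at h2
    have a0 : 0 ≤ μ.real A := measureReal_nonneg
    have a1 : μ.real A ≤ 1 := measureReal_le_one
    have b0 : 0 ≤ μ.real B := measureReal_nonneg
    have b1 : μ.real B ≤ 1 := measureReal_le_one
    rw [abs_le] at *
    constructor <;> nlinarith
  have h0 : μ.real A - μ.real A * μ.real A = 0 := by
    by_contra hne
    have hpos := abs_pos.mpr hne
    have := key (|μ.real A - μ.real A * μ.real A| / 8) (by positivity)
    linarith
  have h5 : μ.real A = 0 ∨ μ.real A = 1 := by
    have : μ.real A * (1 - μ.real A) = 0 := by linarith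
    rcases mul_eq_zero.mp this with h | h
    · exact Or.inl h
    · right; linarith
  rcases h5 with h | h
  · left
    exact (measureReal_eq_zero_iff (measure_ne_top _ _)).mp h
  · right
    rw [measureReal_def] at h
    rw [← ENNReal.toReal_eq_one_iff]; exact h

end Bern

section Combine
open Monoid

variable {A B F T Y : Type} [Group A] [Group B] [Group F] [Group T]

/-- Projection of the big group onto the first factor. -/
def prj (A F T : Type) [Group A] [Group F] [Group T] : Coprod (A × F) T →* A :=
  Coprod.lift (MonoidHom.fst A F) 1

/-- The orbit cocycle. -/
noncomputable def theta (α : A →* Equiv.Perm Y) (β : B →* Equiv.Perm Y)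
    (h : ∀ b y, ∃ a, α a y = β b y) (y : Y) (b : B) : A := (h b y).choose

theorem theta_spec (α : A →* Equiv.Perm Y) (β : B →* Equiv.Perm Y)
    (h : ∀ b y, ∃ a, α a y = β b y) (y : Y) (b : B) : α (theta α β h y b) y = β b y :=
  (h b y).choose_spec

theorem act_inj (α : A →* Equiv.Perm Y) (hα : ∀ a y, α a y = y → a = 1) {a a' : A} {y : Y}
    (h : α a y = α a' y) : a = a' := by
  have := hα (a'⁻¹ * a) y (by
    rw [map_mul, Equiv.Perm.mul_apply, h, ← Equiv.Perm.mul_apply, ← map_mul]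
    simp)
  rw [inv_mul_eq_one] at this
  exact this.symm

/-- Extension of the cocycle as an action on `Y × Γ`. -/
noncomputable def cocEnd (F T : Type) [Group F] [Group T]
    (α : A →* Equiv.Perm Y) (β : B →* Equiv.Perm Y)
    (hα : ∀ a y, α a y = y → a = 1) (h : ∀ b y, ∃ a, α a y = β b y) :
    Coprod (B × F) T →* Function.End (Y × Coprod (A × F) T) :=
  Coprod.lift
    { toFun := fun p x => (β p.1 x.1, Coprod.inl (theta α β h x.1 p.1, p.2) * x.2)
      map_one' := by
        funext x
        have : theta α β h x.1 1 = 1 := hα _ x.1 (by rw [theta_spec]; simp)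
        simp only [Prod.fst_one, Prod.snd_one, this]
        rw [← Prod.one_eq_mk, map_one, map_one]
        simp [Function.End.one_def]
      map_mul' := fun p q => by
        funext x
        have : theta α β h x.1 (p.1 * q.1) =
            theta α β h (β q.1 x.1) p.1 * theta α β h x.1 q.1 := by
          refine act_inj α hα (y := x.1) ?_
          rw [theta_spec, map_mul, map_mul, Equiv.Perm.mul_apply, Equiv.Perm.mul_apply,
            theta_spec, theta_spec]
        change (β (p.1 * q.1) x.1, Coprod.inl (theta α β h x.1 (p.1 * q.1), p.2 * q.2) * x.2) =
          (β p.1 (β q.1 x.1), Coprod.inl (theta α β h (β q.1 x.1) p.1, p.2) *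
            (Coprod.inl (theta α β h x.1 q.1, q.2) * x.2))
        rw [this, ← mul_assoc, ← map_mul, Prod.mk_mul_mk, map_mul, Equiv.Perm.mul_apply] }
    { toFun := fun t x => (x.1, Coprod.inr t * x.2)
      map_one' := by
        funext x
        simp [Function.End.one_def]
      map_mul' := fun p q => by
        funext x
        change (x.1, Coprod.inr (p * q) * x.2) = (x.1, Coprod.inr p * (Coprod.inr q * x.2))
        rw [map_mul, mul_assoc] }

/-- The extended cocycle. -/
noncomputable def bigTheta (F T : Type) [Group F] [Group T]
    (α : A →* Equiv.Perm Y) (β : B →* Equiv.Perm Y)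
    (hα : ∀ a y, α a y = y → a = 1) (h : ∀ b y, ∃ a, α a y = β b y) (y : Y)
    (l : Coprod (B × F) T) : Coprod (A × F) T := (cocEnd F T α β hα h l (y, 1)).2

section
variable (α : A →* Equiv.Perm Y) (β : B →* Equiv.Perm Y)
    (hα : ∀ a y, α a y = y → a = 1) (h : ∀ b y, ∃ a, α a y = β b y)

theorem cocEnd_inl (p : B × F) (x : Y × Coprod (A × F) T) :
    cocEnd F T α β hα h (Coprod.inl p) x =
      (β p.1 x.1, Coprod.inl (theta α β h x.1 p.1, p.2) * x.2) := rfl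

theorem cocEnd_inr (t : T) (x : Y × Coprod (A × F) T) :
    cocEnd F T α β hα h (Coprod.inr t) x = (x.1, Coprod.inr t * x.2) := rfl

theorem cocEnd_mul (l m : Coprod (B × F) T) (x : Y × Coprod (A × F) T) :
    cocEnd F T α β hα h (l * m) x = cocEnd F T α β hα h l (cocEnd F T α β hα h m x) := by
  rw [map_mul]; rfl

theorem cocEnd_apply (l : Coprod (B × F) T) : ∀ (y : Y) (g : Coprod (A × F) T),
    cocEnd F T α β hα h l (y, g) = (β (prj B F T l) y, bigTheta F T α β hα h y l * g) := by
  induction l using Coprod.induction_on with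
  | inl p => intro y g; simp [bigTheta, cocEnd_inl, prj]
  | inr t => intro y g; simp [bigTheta, cocEnd_inr, prj]
  | mul l m hl hm =>
    intro y g
    have e : ∀ g, cocEnd F T α β hα h (l * m) (y, g) =
      (β (prj B F T (l * m)) y, bigTheta F T α β hα h (β (prj B F T m) y) l *
        (bigTheta F T α β hα h y m * g)) := by
      intro g
      rw [cocEnd_mul, hm, hl, map_mul, map_mul]
      rfl
    rw [e]
    have : bigTheta F T α β hα h y (l * m) = bigTheta F T α β hα h (β (prj B F T m) y) l *
        bigTheta F T α β hα h y m := by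
      rw [bigTheta, e]; simp
    rw [this, mul_assoc]

theorem bigTheta_mul (l m : Coprod (B × F) T) (y : Y) :
    bigTheta F T α β hα h y (l * m) = bigTheta F T α β hα h (β (prj B F T m) y) l *
        bigTheta F T α β hα h y m := by
  conv_lhs => rw [bigTheta, cocEnd_mul, cocEnd_apply, cocEnd_apply]
  simp

theorem bigTheta_inl (p : B × F) (y : Y) :
    bigTheta F T α β hα h y (Coprod.inl p) = Coprod.inl (theta α β h y p.1, p.2) := by
  simp [bigTheta, cocEnd_inl]

theorem bigTheta_inr (t : T) (y : Y) :
    bigTheta F T α β hα h y (Coprod.inr t) = Coprod.inr t := by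
  simp [bigTheta, cocEnd_inr]

theorem bigTheta_one (y : Y) :
    bigTheta F T α β hα h y 1 = 1 := by
  simp [bigTheta, Function.End.one_def]

theorem bigTheta_act (l : Coprod (B × F) T) : ∀ (y : Y),
    α (prj A F T (bigTheta F T α β hα h y l)) y = β (prj B F T l) y := by
  induction l using Coprod.induction_on with
  | inl p => intro y; rw [bigTheta_inl]; simp [prj, theta_spec]
  | inr t => intro y; rw [bigTheta_inr]; simp [prj]
  | mul l m hl hm =>
    intro y
    rw [bigTheta_mul, map_mul, map_mul, Equiv.Perm.mul_apply, hm, hl, map_mul, map_mul,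
      Equiv.Perm.mul_apply]

theorem bigTheta_inv (hβ : ∀ b y, β b y = y → b = 1) (h' : ∀ a y, ∃ b, β b y = α a y)
    (l : Coprod (B × F) T) : ∀ (y : Y),
    bigTheta F T β α hβ h' y (bigTheta F T α β hα h y l) = l := by
  induction l using Coprod.induction_on with
  | inl p =>
    intro y
    rw [bigTheta_inl, bigTheta_inl]
    have : theta β α h' y (theta α β h y p.1) = p.1 := by
      refine act_inj β hβ (y := y) ?_
      rw [theta_spec, theta_spec]
    simp only [this]
  | inr t => intro y; rw [bigTheta_inr, bigTheta_inr]
  | mul l m hl hm =>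
    intro y
    rw [bigTheta_mul, bigTheta_mul, hm, bigTheta_act, hl]

theorem bigTheta_meas [MeasurableSpace Y] [Countable A] [Countable B] [Countable F] [Countable T]
    (hm : ∀ a b, MeasurableSet {y | α a y = β b y}) (hβ : ∀ b, Measurable (β b))
    (l : Coprod (B × F) T) : ∀ g, MeasurableSet {y | bigTheta F T α β hα h y l = g} := by
  induction l using Coprod.induction_on with
  | inl p =>
    intro g
    by_cases hg : ∃ a, Coprod.inl (a, p.2) = g
    · obtain ⟨a, rfl⟩ := hg
      convert hm a p.1 using 1
      ext y
      change _ = _ ↔ _ = _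
      rw [bigTheta_inl, Coprod.inl_injective.eq_iff, Prod.mk.injEq]
      simp only [and_true]
      constructor
      · rintro rfl
        exact theta_spec _ _ _ _ _
      · intro e
        refine act_inj α hα (y := y) ?_
        rw [theta_spec, e]
    · convert MeasurableSet.empty using 1
      ext y
      simp only [Set.mem_empty_iff_false, iff_false]
      intro e
      apply hg
      change bigTheta F T α β hα h y _ = g at e
      rw [bigTheta_inl] at e
      exact ⟨_, e⟩
  | inr t =>
    intro g
    simp only [bigTheta_inr]
    exact MeasurableSet.const _
  | mul l m hl hm =>
    intro g
    have : {y | bigTheta F T α β hα h y (l * m) = g} =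
        ⋃ g', {y | bigTheta F T α β hα h y m = g'} ∩
          β (prj B F T m) ⁻¹' {y | bigTheta F T α β hα h y l = g * g'⁻¹} := by
      ext y
      rw [Set.mem_iUnion]
      constructor
      · intro e
        refine ⟨_, rfl, ?_⟩
        change bigTheta F T α β hα h y (l * m) = g at e
        change bigTheta F T α β hα h _ l = _
        rw [bigTheta_mul] at e
        rw [← e]; simp
      · rintro ⟨g', e1, e2⟩
        change bigTheta F T α β hα h y m = g' at e1
        change bigTheta F T α β hα h _ l = _ at e2
        change bigTheta F T α β hα h y (l * m) = g
        rw [bigTheta_mul, e1, e2]; simp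
    rw [this]
    exact MeasurableSet.iUnion fun g' => (hm g').inter (hβ _ (hl _))

end

theorem combine [MeasurableSpace Y] [StandardBorelSpace Y] [Countable A] [Countable B]
    [Countable F] [Countable T] (ν : Measure Y) [IsProbabilityMeasure ν]
    (α : A →* Equiv.Perm Y) (β : B →* Equiv.Perm Y)
    (hα : ∀ a y, α a y = y → a = 1) (hβ : ∀ b y, β b y = y → b = 1)
    (h : ∀ b y, ∃ a, α a y = β b y) (h' : ∀ a y, ∃ b, β b y = α a y)
    (hm : ∀ a b, MeasurableSet {y | α a y = β b y})
    (hpmp : IsPMPAction ν α) (herg : IsErgodicAction ν α)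
    (t : T) (ht : Function.Injective fun n : ℕ => t ^ n) :
    AreOrbitEquivalent (Coprod (A × F) T) (Coprod (B × F) T) := by
  have hβm : ∀ b, Measurable (β b) := fun b =>
    (mp_of_full_action ν α hpmp (β b) (fun y => theta α β h y b) (fun a => by
      convert hm a b using 1
      ext y
      change _ = _ ↔ _ = _
      constructor
      · rintro rfl
        exact theta_spec _ _ _ _ _
      · intro e
        refine act_inj α hα (y := y) ?_
        rw [theta_spec, e]) (fun y => (theta_spec _ _ _ _ _).symm)).measurable
  let Γ := Coprod (A × F) T
  let Λ := Coprod (B × F) T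
  let κ := bern Γ
  let Θ := bigTheta F T α β hα h
  let μ : Measure (Y × (Γ → unitInterval)) := ν.prod (bernM Γ)
  let a : Γ →* Equiv.Perm (Y × (Γ → unitInterval)) :=
    { toFun := fun g => Equiv.prodCongr (α (prj A F T g)) (κ g)
      map_one' := by ext x <;> simp
      map_mul' := fun g g' => by
        apply Equiv.ext
        intro x
        simp only [map_mul]
        rfl }
  have ha_apply : ∀ g x, a g x = (α (prj A F T g) x.1, κ g x.2) := fun g x => rfl
  let b : Λ →* Equiv.Perm (Y × (Γ → unitInterval)) := MonoidHom.toHomPerm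
    { toFun := fun l x => a (Θ x.1 l) x
      map_one' := by
        funext x
        change a (bigTheta F T α β hα h x.1 1) x = x
        rw [bigTheta_one, map_one]; rfl
      map_mul' := fun l m => by
        funext x
        change a (bigTheta F T α β hα h x.1 (l * m)) x =
          a (Θ (a (bigTheta F T α β hα h x.1 m) x).1 l) (a (bigTheta F T α β hα h x.1 m) x)
        rw [bigTheta_mul, map_mul, Equiv.Perm.mul_apply]
        congr 3
        rw [ha_apply, bigTheta_act] }
  have hb_apply : ∀ l x, b l x = a (Θ x.1 l) x := fun l x => rfl
  have hapmp : IsPMPAction μ a := fun g => (hpmp _).prod (bern_pmp Γ g)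
  have hafree : IsFreeAction μ a := by
    intro g hg
    have h1 : {x | a g x = x} ⊆ Prod.snd ⁻¹' {k | κ g k = k} := fun x hx =>
      congrArg Prod.snd hx
    refine measure_mono_null h1 ?_
    exact Measure.quasiMeasurePreserving_snd.preimage_null (bern_free Γ g hg)
  have hainj : ∀ y, Function.Injective (Θ y) := fun y l m e => by
    have := congrArg (bigTheta F T β α hβ h' y) e
    rwa [bigTheta_inv, bigTheta_inv] at this
  have hsurj : ∀ y, Function.Surjective (Θ y) := fun y g =>
    ⟨bigTheta F T β α hβ h' y g, bigTheta_inv β α hβ h' hα h g y⟩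
  have horb : ∀ x, orbitOf a x = orbitOf b x := by
    intro x
    ext z
    constructor
    · rintro ⟨g, rfl⟩
      obtain ⟨l, rfl⟩ := hsurj x.1 g
      exact ⟨l, rfl⟩
    · rintro ⟨l, rfl⟩
      exact ⟨Θ x.1 l, rfl⟩
  have haerg : IsErgodicAction μ a := by
    intro S hS hinv
    have hinv' : ∀ g x, a g x ∈ S ↔ x ∈ S := fun g x => Set.ext_iff.mp (hinv g) x
    let s : Y → Set (Γ → unitInterval) := fun y => Prod.mk y ⁻¹' S
    have hs : ∀ y, MeasurableSet (s y) := fun y => measurable_prodMk_left hS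
    have h01 : ∀ y, bernM Γ (s y) = 0 ∨ bernM Γ (s y) = 1 := by
      intro y
      refine bern_erg Γ (Coprod.inr t) ?_ (s y) (hs y) ?_
      · intro n m e
        simp only [← map_pow] at e
        exact ht (Coprod.inr_injective e)
      · ext k
        have := hinv' (Coprod.inr t) (y, k)
        rw [ha_apply] at this
        simp only [prj, Coprod.lift_apply_inr, MonoidHom.one_apply, map_one] at this
        exact this
    let S' : Set Y := {y | bernM Γ (s y) = 1}
    have hS'm : MeasurableSet S' :=
      (measurable_measure_prodMk_left hS) (measurableSet_singleton 1)
    have hS'inv : ∀ c : A, α c ⁻¹' S' = S' := by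
      intro c
      ext y
      change bernM Γ (s (α c y)) = 1 ↔ bernM Γ (s y) = 1
      have e : s y = κ (Coprod.inl (c, 1)) ⁻¹' (s (α c y)) := by
        ext k
        have := hinv' (Coprod.inl (c, 1)) (y, k)
        rw [ha_apply] at this
        simp only [prj, Coprod.lift_apply_inl] at this
        exact this.symm
      rw [e, (bern_pmp Γ _).measure_preimage (hs _).nullMeasurableSet]
    have hμS : μ S = ν S' := by
      change (ν.prod (bernM Γ)) S = ν S'
      rw [Measure.prod_apply hS]
      have : (fun y => bernM Γ (Prod.mk y ⁻¹' S)) = S'.indicator 1 := by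
        funext y
        by_cases hy : y ∈ S'
        · rw [Set.indicator_of_mem hy]; exact hy
        · rw [Set.indicator_of_notMem hy]
          exact (h01 y).resolve_right hy
      rw [this, lintegral_indicator_one hS'm]
    rw [hμS]
    exact herg S' hS'm hS'inv
  refine ⟨Y × (Γ → unitInterval), inferInstance, μ, inferInstance, ?_, a, b, hapmp, hafree, haerg,
    ?_, ?_, ?_, Filter.Eventually.of_forall horb⟩
  · change IsProbabilityMeasure (ν.prod (bernM Γ))
    infer_instance
  · intro l
    refine mp_of_full_action μ a hapmp (b l) (fun x => Θ x.1 l) (fun g => ?_)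
      (fun x => hb_apply l x)
    exact measurable_fst (bigTheta_meas α β hα h hm hβm l g)
  · intro l hl
    have : {x | b l x = x} ⊆ ⋃ (g : Γ) (_ : g ≠ 1), {x | a g x = x} := by
      intro x hx
      simp only [Set.mem_iUnion]
      refine ⟨Θ x.1 l, fun e => hl (hainj x.1 (e.trans (bigTheta_one α β hα h x.1).symm)), hx⟩
    refine measure_mono_null this ?_
    rw [measure_iUnion_null_iff]
    intro g
    rw [measure_iUnion_null_iff]
    intro hg
    exact hafree g hg
  · intro S hS hinv
    refine haerg S hS fun g => ?_
    ext x
    obtain ⟨l, rfl⟩ := hsurj x.1 g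
    exact Set.ext_iff.mp (hinv l) x

end Combine

section Tail
open Measure ProbabilityTheory

/-- The product space. -/
abbrev PP := (n : ℕ) → Fin (n + 1)

/-- Partial products. -/
def gp {G : Type} [Group G] (t : (n : ℕ) → Fin (n + 1) → G) : ℕ → PP → G
  | 0, _ => 1
  | N + 1, y => gp t N y * t N (y N)

/-- Agreement from `N` on. -/
def TE (N : ℕ) (y z : PP) : Prop := ∀ n, N ≤ n → y n = z n

/-- The graph of the action. -/
def Rl {G : Type} [Group G] (t : (n : ℕ) → Fin (n + 1) → G) (a : G) (y z : PP) : Prop :=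
  ∃ N, TE N y z ∧ gp t N z = a * gp t N y

/-- Replacing the first coordinates. -/
def splice (N : ℕ) (w y : PP) : PP := fun n => if n < N then w n else y n

theorem te_splice (N : ℕ) (w y : PP) : TE N y (splice N w y) := fun n hn => by
  simp [splice, Nat.not_lt.mpr hn]

theorem TE.mono {N M : ℕ} {y z : PP} (h : TE N y z) (hNM : N ≤ M) : TE M y z :=
  fun n hn => h n (hNM.trans hn)

theorem TE.trans {N : ℕ} {y z w : PP} (h : TE N y z) (h' : TE N z w) : TE N y w :=
  fun n hn => (h n hn).trans (h' n hn)

theorem TE.symm {N : ℕ} {y z : PP} (h : TE N y z) : TE N z y :=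
  fun n hn => (h n hn).symm

section gen
variable {G : Type} [Group G] (t : (n : ℕ) → Fin (n + 1) → G)

theorem gp_congr {N : ℕ} {y z : PP} (h : ∀ n < N, y n = z n) : gp t N y = gp t N z := by
  induction N with
  | zero => rfl
  | succ N ih =>
    rw [gp, gp, ih fun n hn => h n (by omega), h N (by omega)]

theorem gp_splice (N : ℕ) (w y : PP) : gp t N (splice N w y) = gp t N w :=
  gp_congr t fun n hn => by simp [splice, hn]

theorem gp_mono {N M : ℕ} {y z : PP} {a : G} (h : TE N y z) (ha : gp t N z = a * gp t N y)
    (hNM : N ≤ M) : gp t M z = a * gp t M y := by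
  induction M, hNM using Nat.le_induction with
  | base => exact ha
  | succ M hM ih => rw [gp, gp, ih, h M hM, mul_assoc]

variable {t}

theorem Rl.of_te {N : ℕ} {y z : PP} (h : TE N y z) : ∃ a, Rl t a y z :=
  ⟨gp t N z * (gp t N y)⁻¹, N, h, by simp⟩

theorem Rl.one (y : PP) : Rl t 1 y y := ⟨0, fun _ _ => rfl, by simp⟩

theorem Rl.mul {a b : G} {y z w : PP} (h : Rl t a y z) (h' : Rl t b z w) : Rl t (b * a) y w := by
  obtain ⟨N, h1, h2⟩ := h
  obtain ⟨M, h3, h4⟩ := h'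
  refine ⟨max N M, (h1.mono (le_max_left _ _)).trans (h3.mono (le_max_right _ _)), ?_⟩
  rw [gp_mono t h3 h4 (le_max_right N M), gp_mono t h1 h2 (le_max_left N M), mul_assoc]

theorem Rl.inv {a : G} {y z : PP} (h : Rl t a y z) : Rl t a⁻¹ z y := by
  obtain ⟨N, h1, h2⟩ := h
  exact ⟨N, h1.symm, by rw [h2]; simp⟩

theorem Rl.left_unique {a b : G} {y z : PP} (h : Rl t a y z) (h' : Rl t b y z) : a = b := by
  obtain ⟨N, h1, h2⟩ := h
  obtain ⟨M, h3, h4⟩ := h'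
  have := (gp_mono t h1 h2 (le_max_left N M)).symm.trans (gp_mono t h3 h4 (le_max_right N M))
  exact mul_right_cancel this

theorem Rl.right_unique (hinj : ∀ N y z, gp t N y = gp t N z → ∀ n < N, y n = z n)
    {a : G} {y z w : PP} (h : Rl t a y z) (h' : Rl t a y w) : z = w := by
  obtain ⟨N, h1, h2⟩ := h
  obtain ⟨M, h3, h4⟩ := h'
  have := (gp_mono t h1 h2 (le_max_left N M)).trans (gp_mono t h3 h4 (le_max_right N M)).symm
  funext n
  by_cases hn : n < max N M
  · exact hinj _ _ _ this n hn
  · have hn' := not_lt.mp hn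
    rw [← h1 n ((le_max_left _ _).trans hn'), ← h3 n ((le_max_right _ _).trans hn')]

theorem exists_act (hinj : ∀ N y z, gp t N y = gp t N z → ∀ n < N, y n = z n) (Y : Set PP)
    (hY : ∀ y ∈ Y, ∀ N z, TE N y z → z ∈ Y) (hgood : ∀ y ∈ Y, ∀ a, ∃ z, Rl t a y z) :
    ∃ α : G →* Equiv.Perm Y, ∀ a y, Rl t a y.1 (α a y).1 := by
  have : ∀ (a : G) (y : Y), ∃ z : Y, Rl t a y.1 z.1 := fun a y => by
    obtain ⟨z, hz⟩ := hgood y.1 y.2 a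
    obtain ⟨N, h1, _⟩ := id hz
    exact ⟨⟨z, hY _ y.2 N z h1⟩, hz⟩
  choose f hf using this
  refine ⟨MonoidHom.toHomPerm
    { toFun := f
      map_one' := by
        funext y
        exact Subtype.ext ((hf 1 y).right_unique hinj (Rl.one _))
      map_mul' := fun a b => by
        funext y
        exact Subtype.ext ((hf (a * b) y).right_unique hinj ((hf b y).mul (hf a (f b y)))) },
    hf⟩

end gen

/-- Finite coordinatewise permutations. -/
abbrev IX := Σ N : ℕ, ((n : Fin N) → Equiv.Perm (Fin (n.1 + 1)))

/-- The coordinatewise permutation. -/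
def mm (i : IX) : Equiv.Perm PP :=
  Equiv.piCongrRight fun n => if h : n < i.1 then i.2 ⟨n, h⟩ else 1

theorem mm_te (i : IX) (y : PP) : TE i.1 y (mm i y) := fun n hn => by
  simp [mm, Nat.not_lt.mpr hn]

theorem exists_mm {N : ℕ} {y z : PP} (h : TE N y z) : ∃ i, mm i y = z := by
  refine ⟨⟨N, fun n => Equiv.swap (y n) (z n)⟩, ?_⟩
  funext n
  by_cases hn : n < N
  · simp [mm, hn]
  · simp [mm, hn, h n (not_lt.mp hn)]

/-- Uniform measure. -/
noncomputable def un (n : ℕ) : Measure (Fin (n + 1)) := (PMF.uniformOfFintype (Fin (n + 1))).toMeasure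

instance (n : ℕ) : IsProbabilityMeasure (un n) := by unfold un; infer_instance

theorem un_singleton (n : ℕ) (x : Fin (n + 1)) : un n {x} = ((n + 1 : ℕ) : ENNReal)⁻¹ := by
  rw [un, PMF.toMeasure_apply_singleton _ _ (measurableSet_singleton x)]
  simp

theorem un_map (n : ℕ) (e : Equiv.Perm (Fin (n + 1))) : (un n).map e = un n := by
  refine Measure.ext_of_singleton fun x => ?_
  rw [Measure.map_apply (measurable_of_finite _) (measurableSet_singleton x)]
  have : e ⁻¹' {x} = {e.symm x} := by
    ext y; simp [Equiv.eq_symm_apply]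
  rw [this, un_singleton, un_singleton]

/-- The product measure. -/
noncomputable def nu : Measure PP := infinitePi un

instance : IsProbabilityMeasure nu := by unfold nu; infer_instance

theorem mm_meas (i : IX) : Measurable (mm i) :=
  measurable_pi_lambda _ fun n => (measurable_of_finite _).comp (measurable_pi_apply n)

theorem mm_meas_symm (i : IX) : Measurable (mm i).symm :=
  measurable_pi_lambda _ fun n => (measurable_of_finite _).comp (measurable_pi_apply n)

theorem mm_mp (i : IX) : MeasurePreserving (mm i) nu nu := by
  refine ⟨mm_meas i, ?_⟩
  have := infinitePi_map_pi (μ := un)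
    (f := fun n => ((if h : n < i.1 then i.2 ⟨n, h⟩ else 1 : Equiv.Perm (Fin (n + 1)))))
    (fun n => measurable_of_finite _)
  simp only [un_map] at this
  exact this

theorem rl_meas {G : Type} [Group G] [Countable G] (t : (n : ℕ) → Fin (n + 1) → G) (a : G)
    (i : IX) : MeasurableSet {y | Rl t a y (mm i y)} := by
  letI : MeasurableSpace G := ⊤
  haveI : DiscreteMeasurableSpace G := ⟨fun _ => trivial⟩
  have hgp : ∀ N, Measurable (gp t N) := by
    intro N
    induction N with
    | zero => exact measurable_const
    | succ N ih =>
      have h2 : Measurable fun y : PP => t N (y N) :=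
        (measurable_of_finite (t N)).comp (measurable_pi_apply N)
      exact ih.mul h2
  have : {y | Rl t a y (mm i y)} = ⋃ N, ((⋂ n, ⋂ (_ : N ≤ n), {y : PP | y n = mm i y n}) ∩
      {y | gp t N (mm i y) = a * gp t N y}) := by
    ext y
    simp only [Set.mem_iUnion, Set.mem_inter_iff, Set.mem_iInter]
    rfl
  rw [this]
  refine MeasurableSet.iUnion fun N => (MeasurableSet.iInter fun n => MeasurableSet.iInter
    fun _ => ?_).inter ?_
  · exact measurableSet_eq_fun (measurable_pi_apply n)
      ((measurable_pi_apply n).comp (mm_meas i))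
  · exact measurableSet_eq_fun ((hgp N).comp (mm_meas i)) ((hgp N).const_mul a)

theorem tail01 (S : Set PP) (hS : MeasurableSet S)
    (hinv : ∀ y N z, TE N y z → y ∈ S → z ∈ S) : nu S = 0 ∨ nu S = 1 := by
  have hi := iIndepFun_infinitePi (P := un) (X := fun _ x => x) (fun _ => measurable_id)
  rw [iIndepFun_iff_iIndep] at hi
  refine measure_zero_or_one_of_measurableSet_limsup_atTop (fun n => ?_) hi ?_
  · exact (measurable_pi_apply n).comap_le
  · rw [Filter.limsup_eq_iInf_iSup_of_nat, MeasurableSpace.measurableSet_iInf]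
    intro N
    have e : S = (fun y => splice N (fun _ => 0) y) ⁻¹' S := by
      ext y
      exact ⟨hinv y N _ (te_splice _ _ _), hinv _ N _ (te_splice _ _ _).symm⟩
    rw [e]
    refine Measurable.of_comap_le ?_ |> fun h => h hS
    refine Measurable.comap_le ?_
    refine @measurable_pi_lambda _ _ _ (_) _ _ fun n => ?_
    by_cases hn : n < N
    · simp only [splice, hn, if_true]
      exact @measurable_const _ _ _ (_) _
    · simp only [splice, hn, if_false]
      refine Measurable.of_comap_le ?_
      exact le_iSup₂_of_le n (not_lt.mp hn) le_rfl

theorem mp_of_full_ex {X ι : Type*} [MeasurableSpace X] [Countable ι] (μ : Measure X)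
    (m : ι → Equiv.Perm X) (hm : ∀ i, MeasurePreserving (m i) μ μ)
    (hm' : ∀ i, Measurable (m i).symm) (f : Equiv.Perm X)
    (hc : ∀ i, MeasurableSet {x | f x = m i x}) (hf : ∀ x, ∃ i, f x = m i x) :
    MeasurePreserving f μ μ := by
  haveI := Encodable.ofCountable ι
  have : ∀ x, ∃ i, f x = m i x ∧ ∀ j, f x = m j x → Encodable.encode i ≤ Encodable.encode j := by
    intro x
    obtain ⟨i, hi, hmin⟩ := WellFounded.has_min (measure (Encodable.encode : ι → ℕ)).wf
      {i | f x = m i x} (hf x)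
    exact ⟨i, hi, fun j hj => not_lt.mp (hmin j hj)⟩
  choose c hc1 hc2 using this
  refine mp_of_full μ m hm hm' f c (fun i => ?_) hc1
  have : {x | c x = i} = {x | f x = m i x} ∩
      ⋂ j, ⋂ (_ : Encodable.encode j < Encodable.encode i), {x | f x = m j x}ᶜ := by
    ext x
    simp only [Set.mem_inter_iff, Set.mem_iInter, Set.mem_compl_iff]
    constructor
    · rintro rfl
      exact ⟨hc1 x, fun j hj hj' => absurd (hc2 x j hj') (not_le.mpr hj)⟩
    · rintro ⟨h1, h2⟩
      have h3 := hc2 x i h1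
      have h4 : ¬ Encodable.encode (c x) < Encodable.encode i := fun h => h2 _ h (hc1 x)
      exact Encodable.encode_injective (le_antisymm h3 (not_lt.mp h4))
  rw [this]
  exact (hc i).inter (MeasurableSet.iInter fun j => MeasurableSet.iInter fun _ => (hc j).compl)

theorem te_mm_mem {Y : Set PP} (hY : ∀ y ∈ Y, ∀ N z, TE N y z → z ∈ Y) (i : IX) (y : PP) :
    mm i y ∈ Y ↔ y ∈ Y :=
  ⟨fun h => hY _ h _ _ (mm_te i y).symm, fun h => hY _ h _ _ (mm_te i y)⟩

theorem tail_oe {A B : Type} [Group A] [Group B] [Countable A] [Countable B]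
    (t : (n : ℕ) → Fin (n + 1) → A) (s : (n : ℕ) → Fin (n + 1) → B)
    (hinjt : ∀ N y z, gp t N y = gp t N z → ∀ n < N, y n = z n)
    (hinjs : ∀ N y z, gp s N y = gp s N z → ∀ n < N, y n = z n)
    (hgt : ∀ y a, ∃ z, Rl t a y z)
    (hnull : nu {y | ∀ b, ∃ z, Rl s b y z}ᶜ = 0) :
    ∃ (Y : Type) (mY : MeasurableSpace Y) (_ : StandardBorelSpace Y) (ν : Measure Y)
      (_ : IsProbabilityMeasure ν)
      (α : A →* Equiv.Perm Y) (β : B →* Equiv.Perm Y),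
      (∀ a y, α a y = y → a = 1) ∧ (∀ b y, β b y = y → b = 1) ∧
      (∀ b y, ∃ a, α a y = β b y) ∧ (∀ a y, ∃ b, β b y = α a y) ∧
      (∀ a b, MeasurableSet {y | α a y = β b y}) ∧
      IsPMPAction ν α ∧ IsErgodicAction ν α := by
  set Y : Set PP := {y | ∀ b, ∃ z, Rl s b y z} with hYdef
  have hY : ∀ y ∈ Y, ∀ N z, TE N y z → z ∈ Y := by
    intro y hy N z hyz b
    obtain ⟨c, hc⟩ := Rl.of_te (t := s) hyz
    obtain ⟨w, hw⟩ := hy (b * c)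
    refine ⟨w, ?_⟩
    have := hc.inv.mul hw
    simpa using this
  have hYm : MeasurableSet Y := by
    have : Y = ⋂ b, ⋃ i, {y | Rl s b y (mm i y)} := by
      ext y
      simp only [Set.mem_iInter, Set.mem_iUnion]
      constructor
      · intro hy b
        obtain ⟨z, hz⟩ := hy b
        obtain ⟨N, h1, _⟩ := id hz
        obtain ⟨i, rfl⟩ := exists_mm h1
        exact ⟨i, hz⟩
      · intro hy b
        obtain ⟨i, hi⟩ := hy b
        exact ⟨_, hi⟩
    rw [this]
    exact MeasurableSet.iInter fun b => MeasurableSet.iUnion fun i => rl_meas s b i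
  obtain ⟨α, hα⟩ := exists_act hinjt Y hY (fun y _ a => hgt y a)
  obtain ⟨β, hβ⟩ := exists_act hinjs Y hY (fun y hy a => hy a)
  have hYone : nu Y = 1 := (prob_compl_eq_zero_iff hYm).mp hnull
  let ν : Measure Y := nu.comap Subtype.val
  have hν : ∀ S : Set Y, ν S = nu (Subtype.val '' S) := fun S => comap_subtype_coe_apply hYm _ S
  have hprob : IsProbabilityMeasure ν := ⟨by rw [hν]; simpa using hYone⟩
  have hstd : StandardBorelSpace Y := hYm.standardBorel
  have hαi : ∀ a (y : Y) i, (α a y).1 = mm i y.1 ↔ Rl t a y.1 (mm i y.1) := fun a y i =>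
    ⟨fun h => h ▸ hα a y, fun h => (hα a y).right_unique hinjt h⟩
  have hβi : ∀ a (y : Y) i, (β a y).1 = mm i y.1 ↔ Rl s a y.1 (mm i y.1) := fun a y i =>
    ⟨fun h => h ▸ hβ a y, fun h => (hβ a y).right_unique hinjs h⟩
  have hαex : ∀ a (y : Y), ∃ i, (α a y).1 = mm i y.1 := fun a y => by
    obtain ⟨N, h1, _⟩ := hα a y
    obtain ⟨i, hi⟩ := exists_mm h1
    exact ⟨i, hi.symm⟩
  let m' : IX → Equiv.Perm Y := fun i => (mm i).subtypePerm (te_mm_mem hY i)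
  have hm'v : ∀ i y, (m' i y).1 = mm i y.1 := fun i y => rfl
  have hm'meas : ∀ i, Measurable (m' i) := fun i =>
    ((mm_meas i).comp measurable_subtype_coe).subtype_mk
  have hm'symm : ∀ i, Measurable (m' i).symm := fun i =>
    ((mm_meas_symm i).comp measurable_subtype_coe).subtype_mk
  have hm'mp : ∀ i, MeasurePreserving (m' i) ν ν := by
    intro i
    refine ⟨hm'meas i, ?_⟩
    ext S hS
    rw [Measure.map_apply (hm'meas i) hS, hν, hν]
    have : Subtype.val '' (m' i ⁻¹' S) = mm i ⁻¹' (Subtype.val '' S) := by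
      ext y
      constructor
      · rintro ⟨z, hz, rfl⟩
        exact ⟨_, hz, rfl⟩
      · rintro ⟨z, hz, hzy⟩
        have hy : y ∈ Y := (te_mm_mem hY i y).mp (hzy ▸ z.2)
        refine ⟨⟨y, hy⟩, ?_, rfl⟩
        have : m' i ⟨y, hy⟩ = z := Subtype.ext hzy.symm
        change m' i ⟨y, hy⟩ ∈ S
        rw [this]; exact hz
    rw [this, (mm_mp i).measure_preimage (hYm.subtype_image hS).nullMeasurableSet]
  refine ⟨Y, inferInstance, hstd, ν, hprob, α, β, ?_, ?_, ?_, ?_, ?_, ?_, ?_⟩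
  · intro a y h
    have := hα a y
    rw [h] at this
    exact this.left_unique (Rl.one _)
  · intro a y h
    have := hβ a y
    rw [h] at this
    exact this.left_unique (Rl.one _)
  · intro b y
    obtain ⟨N, h1, _⟩ := hβ b y
    obtain ⟨a, ha⟩ := Rl.of_te (t := t) h1
    exact ⟨a, Subtype.ext ((hα a y).right_unique hinjt ha)⟩
  · intro b y
    obtain ⟨N, h1, _⟩ := hα b y
    obtain ⟨a, ha⟩ := Rl.of_te (t := s) h1
    exact ⟨a, Subtype.ext ((hβ a y).right_unique hinjs ha)⟩
  · intro a b
    have : {y | α a y = β b y} = ⋃ i, ((Subtype.val ⁻¹' {y | Rl t a y (mm i y)}) ∩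
        (Subtype.val ⁻¹' {y | Rl s b y (mm i y)}) : Set Y) := by
      ext y
      simp only [Set.mem_iUnion, Set.mem_inter_iff]
      constructor
      · intro h
        obtain ⟨i, hi⟩ := hαex a y
        refine ⟨i, (hαi a y i).mp hi, (hβi b y i).mp ?_⟩
        rw [← hi]; exact congrArg Subtype.val h.symm
      · rintro ⟨i, h1, h2⟩
        exact Subtype.ext (((hαi a y i).mpr h1).trans ((hβi b y i).mpr h2).symm)
    rw [this]
    exact MeasurableSet.iUnion fun i => (measurable_subtype_coe (rl_meas t a i)).inter
      (measurable_subtype_coe (rl_meas s b i))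
  · intro a
    refine mp_of_full_ex ν m' hm'mp hm'symm (α a) (fun i => ?_) (fun y => ?_)
    · have : {y | α a y = m' i y} = Subtype.val ⁻¹' {y | Rl t a y (mm i y)} := by
        ext y
        constructor
        · intro h
          exact (hαi a y i).mp (congrArg Subtype.val h)
        · intro h
          exact Subtype.ext ((hαi a y i).mpr h)
      rw [this]
      exact measurable_subtype_coe (rl_meas t a i)
    · obtain ⟨i, hi⟩ := hαex a y
      exact ⟨i, Subtype.ext hi⟩
  · intro S hS hinv
    rw [hν]
    refine tail01 _ (hYm.subtype_image hS) ?_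
    rintro _ N z hyz ⟨y, hy, rfl⟩
    obtain ⟨a, ha⟩ := Rl.of_te (t := t) hyz
    refine ⟨α a y, ?_, (hα a y).right_unique hinjt ha⟩
    exact (Set.ext_iff.mp (hinv a) y).mpr hy

end Tail

section Specific
open Measure ProbabilityTheory

/-- Transposition cosets for the finitary symmetric group. -/
def tS (n : ℕ) (j : Fin (n + 1)) : SInf :=
  ⟨Equiv.swap (j : ℕ) n, by
    refine Set.Finite.subset (Set.toFinite {(j : ℕ), n}) ?_
    intro m hm
    by_contra h
    simp only [Set.mem_insert_iff, Set.mem_singleton_iff, not_or] at h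
    exact hm (Equiv.swap_apply_of_ne_of_ne h.1 h.2)⟩

theorem tS_fix (n : ℕ) (j : Fin (n + 1)) (m : ℕ) (hm : n < m) : (tS n j).1 m = m :=
  Equiv.swap_apply_of_ne_of_ne (by have := j.2; omega) (by omega)

theorem gpS_fix (N : ℕ) (y : PP) : ∀ m, N ≤ m → (gp tS N y).1 m = m := by
  induction N with
  | zero => intro m _; rfl
  | succ N ih =>
    intro m hm
    change (gp tS N y).1 ((tS N (y N)).1 m) = m
    rw [tS_fix N _ m (by omega)]
    exact ih m (by omega)

theorem gpS_last (N : ℕ) (y : PP) : (gp tS (N + 1) y).1 (y N : ℕ) = N := by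
  change (gp tS N y).1 ((Equiv.swap (y N : ℕ) N) (y N : ℕ)) = N
  rw [Equiv.swap_apply_left]
  exact gpS_fix N y N le_rfl

theorem gpS_inj : ∀ N y z, gp tS N y = gp tS N z → ∀ n < N, y n = z n := by
  intro N y z
  induction N with
  | zero => intro _ n hn; omega
  | succ N ih =>
    intro h
    have hN : y N = z N := by
      have h1 := gpS_last N y
      rw [h] at h1
      exact Fin.ext ((gp tS (N + 1) z).1.injective (h1.trans (gpS_last N z).symm))
    have h2 : gp tS N y = gp tS N z := by
      rw [gp, gp, hN] at h
      exact mul_right_cancel h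
    intro n hn
    rcases Nat.lt_succ_iff_lt_or_eq.mp hn with h3 | rfl
    · exact ih h2 n h3
    · exact hN

theorem gp_update {G : Type} [Group G] (t : (n : ℕ) → Fin (n + 1) → G) (N : ℕ) (w : PP)
    (j : Fin (N + 1)) : gp t (N + 1) (Function.update w N j) = gp t N w * t N j := by
  rw [gp, Function.update_self]
  congr 1
  refine gp_congr t fun n hn => ?_
  rw [Function.update_of_ne (by omega)]

theorem gpS_surj : ∀ N (s : SInf), (∀ m, N ≤ m → s.1 m = m) → ∃ y, gp tS N y = s := by
  intro N
  induction N with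
  | zero =>
    intro s hs
    refine ⟨fun _ => 0, ?_⟩
    refine Subtype.ext (Equiv.ext fun m => ?_)
    exact (hs m (Nat.zero_le _)).symm
  | succ N ih =>
    intro s hs
    have hj : s.1.symm N < N + 1 := by
      by_contra h
      have h1 := hs (s.1.symm N) (by omega)
      rw [Equiv.apply_symm_apply] at h1
      omega
    obtain ⟨w, hw⟩ := ih (s * (tS N ⟨s.1.symm N, hj⟩)⁻¹) (by
      intro m hm
      change s.1 ((Equiv.swap (s.1.symm N) N).symm m) = m
      rw [Equiv.symm_swap]
      rcases Nat.lt_or_eq_of_le hm with h | rfl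
      · rw [Equiv.swap_apply_of_ne_of_ne (by omega) (by omega)]
        exact hs m h
      · rw [Equiv.swap_apply_right, Equiv.apply_symm_apply])
    refine ⟨Function.update w N ⟨s.1.symm N, hj⟩, ?_⟩
    rw [gp_update, hw, inv_mul_cancel_right]

theorem gpS_good (y : PP) (a : SInf) : ∃ z, Rl tS a y z := by
  obtain ⟨N, hN⟩ : ∃ N, ∀ m, N ≤ m → a.1 m = m := by
    have hfin : {n | a.1 n ≠ n}.Finite := a.2
    obtain ⟨N, hN⟩ := hfin.bddAbove
    refine ⟨N + 1, fun m hm => ?_⟩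
    by_contra h
    have : m ≤ N := hN h
    omega
  obtain ⟨w, hw⟩ := gpS_surj N (a * gp tS N y) (by
    intro m hm
    change a.1 ((gp tS N y).1 m) = m
    rw [gpS_fix N y m hm, hN m hm])
  exact ⟨splice N w y, N, te_splice N w y, by rw [gp_splice, hw]⟩

/-- Factorial digits for the integers. -/
def tZ (n : ℕ) (j : Fin (n + 1)) : Multiplicative ℤ :=
  Multiplicative.ofAdd (((j : ℕ) : ℤ) * (n.factorial : ℤ))

/-- The integer with the given digits. -/
def vl (N : ℕ) (y : PP) : ℤ := Multiplicative.toAdd (gp tZ N y)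

theorem vl_succ (N : ℕ) (y : PP) :
    vl (N + 1) y = vl N y + ((y N : ℕ) : ℤ) * (N.factorial : ℤ) := rfl

theorem vl_bd (N : ℕ) (y : PP) : 0 ≤ vl N y ∧ vl N y < (N.factorial : ℤ) := by
  induction N with
  | zero =>
    have : vl 0 y = 0 := rfl
    simp [this]
  | succ N ih =>
    rw [vl_succ, Nat.factorial_succ]
    push_cast
    have h1 : ((y N : ℕ) : ℤ) ≤ N := by have := (y N).2; omega
    have h0 : (0 : ℤ) ≤ ((y N : ℕ) : ℤ) := by positivity
    have h2 : (0 : ℤ) < (N.factorial : ℤ) := by exact_mod_cast N.factorial_pos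
    constructor
    · nlinarith [mul_nonneg h0 h2.le]
    · nlinarith [mul_le_mul_of_nonneg_right h1 h2.le]

theorem gpZ_inj : ∀ N y z, gp tZ N y = gp tZ N z → ∀ n < N, y n = z n := by
  intro N y z
  induction N with
  | zero => intro _ n hn; omega
  | succ N ih =>
    intro h
    have hv : vl (N + 1) y = vl (N + 1) z := congrArg Multiplicative.toAdd h
    have h2 : (0 : ℤ) < (N.factorial : ℤ) := by exact_mod_cast N.factorial_pos
    have key : ∀ x : PP, vl (N + 1) x / (N.factorial : ℤ) = ((x N : ℕ) : ℤ) := by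
      intro x
      rw [vl_succ, Int.add_mul_ediv_right _ _ h2.ne',
        Int.ediv_eq_zero_of_lt (vl_bd N x).1 (vl_bd N x).2, zero_add]
    have hN : y N = z N := by
      have h1 := key y
      rw [hv, key z] at h1
      exact Fin.ext (by exact_mod_cast h1.symm)
    have h2 : gp tZ N y = gp tZ N z := by
      rw [gp, gp, hN] at h
      exact mul_right_cancel h
    intro n hn
    rcases Nat.lt_succ_iff_lt_or_eq.mp hn with h3 | rfl
    · exact ih h2 n h3
    · exact hN

theorem vl_surj : ∀ N (v : ℤ), 0 ≤ v → v < (N.factorial : ℤ) → ∃ y, vl N y = v := by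
  intro N
  induction N with
  | zero =>
    intro v h0 h1
    refine ⟨fun _ => 0, ?_⟩
    have : vl 0 (fun _ => 0) = 0 := rfl
    rw [this]
    simp at h1
    omega
  | succ N ih =>
    intro v h0 h1
    have h2 : (0 : ℤ) < (N.factorial : ℤ) := by exact_mod_cast N.factorial_pos
    obtain ⟨w, hw⟩ := ih (v % (N.factorial : ℤ)) (Int.emod_nonneg _ h2.ne')
      (Int.emod_lt_of_pos _ h2)
    have hq0 : 0 ≤ v / (N.factorial : ℤ) := Int.ediv_nonneg h0 h2.le
    have hq1 : v / (N.factorial : ℤ) < N + 1 := by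
      refine Int.ediv_lt_of_lt_mul h2 ?_
      rw [Nat.factorial_succ] at h1
      push_cast at h1
      exact h1
    refine ⟨Function.update w N ⟨(v / (N.factorial : ℤ)).toNat, by omega⟩, ?_⟩
    have hu : vl (N + 1) (Function.update w N ⟨(v / (N.factorial : ℤ)).toNat, by omega⟩)
        = vl N w + (((v / (N.factorial : ℤ)).toNat : ℕ) : ℤ) * (N.factorial : ℤ) :=
      congrArg Multiplicative.toAdd (gp_update tZ N w _)
    rw [hu, hw, Int.toNat_of_nonneg hq0]
    exact Int.emod_add_ediv_mul v _

theorem gpZ_good (N : ℕ) (y : PP) (m : ℤ) (h0 : 0 ≤ m + vl N y)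
    (h1 : m + vl N y < (N.factorial : ℤ)) : ∃ z, Rl tZ (Multiplicative.ofAdd m) y z := by
  obtain ⟨w, hw⟩ := vl_surj N _ h0 h1
  refine ⟨splice N w y, N, te_splice N w y, ?_⟩
  rw [gp_splice]
  exact Multiplicative.toAdd.injective hw

theorem nu_cyl (N : ℕ) (v : ℤ) : nu {y | vl N y = v} ≤ ((N.factorial : ℕ) : ENNReal)⁻¹ := by
  rcases Set.eq_empty_or_nonempty {y | vl N y = v} with h | ⟨w, hw⟩
  · rw [h]; simp
  · have hsub : {y | vl N y = v} ⊆ Set.pi (Finset.range N : Set ℕ) (fun n => {w n}) := by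
      intro y hy n hn
      have hn' : n < N := by simpa using hn
      have : vl N y = vl N w := hy.trans hw.symm
      exact gpZ_inj N y w (Multiplicative.toAdd.injective this) n hn'
    refine (measure_mono hsub).trans (le_of_eq ?_)
    rw [nu, infinitePi_pi un (fun n _ => measurableSet_singleton _)]
    simp only [un_singleton]
    induction N with
    | zero => simp
    | succ N ih =>
      clear ih hsub
      clear hw
      generalize N + 1 = M
      induction M with
      | zero => simp
      | succ M ih =>
        rw [Finset.prod_range_succ, ih, Nat.factorial_succ, Nat.cast_mul,
          ENNReal.mul_inv (Or.inr (ENNReal.natCast_ne_top _)) (Or.inl (ENNReal.natCast_ne_top _)),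
          mul_comm]

theorem nullZ (m : ℤ) : nu {y | ¬ ∃ z, Rl tZ (Multiplicative.ofAdd m) y z} = 0 := by
  have hb : ∀ N : ℕ, nu {y | ¬ ∃ z, Rl tZ (Multiplicative.ofAdd m) y z} ≤
      ((2 * m.natAbs : ℕ) : ENNReal) * ((N.factorial : ℕ) : ENNReal)⁻¹ := by
    intro N
    set T : Finset ℤ := Finset.Ico 0 |m| ∪ Finset.Ico ((N.factorial : ℤ) - |m|) (N.factorial : ℤ)
      with hT
    have hcard : T.card ≤ 2 * m.natAbs := by
      refine (Finset.card_union_le _ _).trans ?_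
      rw [Int.card_Ico, Int.card_Ico]
      have := Int.natCast_natAbs m
      omega
    have hsub : {y | ¬ ∃ z, Rl tZ (Multiplicative.ofAdd m) y z} ⊆ ⋃ v ∈ T, {y | vl N y = v} := by
      intro y hy
      simp only [Set.mem_iUnion]
      refine ⟨vl N y, ?_, rfl⟩
      have hbd := vl_bd N y
      have h1 := le_abs_self m
      have h2 := neg_abs_le m
      rw [hT, Finset.mem_union, Finset.mem_Ico, Finset.mem_Ico]
      by_contra hcon
      refine hy (gpZ_good N y m ?_ ?_) <;> omega
    calc nu _ ≤ nu (⋃ v ∈ T, {y | vl N y = v}) := measure_mono hsub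
      _ ≤ ∑ v ∈ T, nu {y | vl N y = v} := measure_biUnion_finset_le _ _
      _ ≤ ∑ v ∈ T, ((N.factorial : ℕ) : ENNReal)⁻¹ := Finset.sum_le_sum fun v _ => nu_cyl N v
      _ = (T.card : ENNReal) * ((N.factorial : ℕ) : ENNReal)⁻¹ := by
        rw [Finset.sum_const, nsmul_eq_mul]
      _ ≤ _ := by gcongr
  have hlim : Filter.Tendsto (fun N : ℕ => ((2 * m.natAbs : ℕ) : ENNReal) *
      ((N.factorial : ℕ) : ENNReal)⁻¹) Filter.atTop (nhds 0) := by
    have h1 : Filter.Tendsto (fun N : ℕ => ((N.factorial : ℕ) : ENNReal)⁻¹) Filter.atTop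
        (nhds 0) := by
      have := ENNReal.tendsto_inv_nat_nhds_zero
      exact this.comp
        (Filter.tendsto_atTop_mono (fun n => Nat.self_le_factorial n) Filter.tendsto_id)
    have := ENNReal.Tendsto.const_mul (a := ((2 * m.natAbs : ℕ) : ENNReal)) h1
      (Or.inr (ENNReal.natCast_ne_top _))
    rwa [mul_zero] at this
  exact le_antisymm (ge_of_tendsto' hlim hb) bot_le

theorem nullZ_all : nu {y | ∀ b, ∃ z, Rl tZ b y z}ᶜ = 0 := by
  have : {y | ∀ b, ∃ z, Rl tZ b y z}ᶜ ⊆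
      ⋃ m : ℤ, {y | ¬ ∃ z, Rl tZ (Multiplicative.ofAdd m) y z} := by
    intro y hy
    simp only [Set.mem_compl_iff, Set.mem_setOf_eq, not_forall] at hy
    obtain ⟨b, hb⟩ := hy
    exact Set.mem_iUnion.mpr ⟨Multiplicative.toAdd b, hb⟩
  exact measure_mono_null this (measure_iUnion_null nullZ)

end Specific

/-- `Γ = (S∞ × F₂) ∗ ℤ` and `Λ = (ℤ × F₂) ∗ ℤ` are countable ICC groups which are
orbit equivalent. -/
theorem main_example :
    Countable (Monoid.Coprod (↥SInf × FreeGroup (Fin 2)) (Multiplicative ℤ)) ∧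
    IsICCGroup (Monoid.Coprod (↥SInf × FreeGroup (Fin 2)) (Multiplicative ℤ)) ∧
    Countable (Monoid.Coprod (Multiplicative ℤ × FreeGroup (Fin 2)) (Multiplicative ℤ)) ∧
    IsICCGroup (Monoid.Coprod (Multiplicative ℤ × FreeGroup (Fin 2)) (Multiplicative ℤ)) ∧
    AreOrbitEquivalent (Monoid.Coprod (↥SInf × FreeGroup (Fin 2)) (Multiplicative ℤ))
      (Monoid.Coprod (Multiplicative ℤ × FreeGroup (Fin 2)) (Multiplicative ℤ)) := by
  refine ⟨inferInstance, icc_coprod _ _, inferInstance, icc_coprod _ _, ?_⟩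
  obtain ⟨Y, mY, _, ν, _, α, β, h1, h2, h3, h4, h5, h6, h7⟩ :=
    tail_oe tS tZ gpS_inj gpZ_inj gpS_good nullZ_all
  refine combine ν α β h1 h2 h3 h4 h5 h6 h7 (Multiplicative.ofAdd (1 : ℤ)) ?_
  intro a b hab
  have h : Multiplicative.toAdd ((Multiplicative.ofAdd (1 : ℤ)) ^ a) =
      Multiplicative.toAdd ((Multiplicative.ofAdd (1 : ℤ)) ^ b) := congrArg _ hab
  simpa using h
end
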